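/- arXiv:2511.10889 — 3 statements merged into one kernel-verified Lean document; each statement's English description precedes it below -/
import Mathlib

section
/- A graph G is (2P_3,C_4,C_6)-free and contains an induced C_7 if and only if G is a 7-saucer. -/
open SimpleGraph

namespace Paper2P3

variable {V : Type*}

/-- `G` contains an induced subgraph isomorphic to `H`. -/
def ContainsInduced {V W : Type*} (G : SimpleGraph V) (H : SimpleGraph W) : Prop :=
  ∃ s : Set V, Nonempty (H ≃g G.induce s)

/-- `G` is `H`-free: no induced subgraph of `G` is isomorphic to `H`. -/
def HFree {V W : Type*} (G : SimpleGraph V) (H : SimpleGraph W) : Prop :=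
  ¬ ContainsInduced G H

/-- `S` is complete to `T` in `G`. -/
def Complete (G : SimpleGraph V) (S T : Set V) : Prop :=
  ∀ a ∈ S, ∀ b ∈ T, G.Adj a b

/-- `S` is anticomplete to `T` in `G`. -/
def Anticomplete (G : SimpleGraph V) (S T : Set V) : Prop :=
  ∀ a ∈ S, ∀ b ∈ T, ¬ G.Adj a b

/-- The closed neighborhood `N_G[v]`. -/
def closedNbhd (G : SimpleGraph V) (v : V) : Set V := insert v (G.neighborSet v)

/-- A simplicial vertex: its neighborhood is a clique. -/
def IsSimplicial (G : SimpleGraph V) (v : V) : Prop := G.IsClique (G.neighborSet v)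

/-- A universal vertex: adjacent to all other vertices. -/
def IsUniversalVertex (G : SimpleGraph V) (v : V) : Prop := ∀ w, w ≠ v → G.Adj v w

/-- `G` admits a clique-cutset: a clique `C ⊊ V(G)` such that `G - C` is disconnected. -/
def HasCliqueCutset (G : SimpleGraph V) : Prop :=
  ∃ C : Set V, G.IsClique C ∧ C ≠ Set.univ ∧ ¬ (G.induce Cᶜ).Connected

/-- The disjoint union of two copies of `P_3`, on vertices `0,1,2` and `3,4,5`. -/
def twoP3 : SimpleGraph (Fin 6) :=
  SimpleGraph.fromRel fun a b => (a, b) ∈ ([(0,1),(1,2),(3,4),(4,5)] : List (Fin 6 × Fin 6))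

/-- The edgeless graph on four vertices. -/
def fourK1 : SimpleGraph (Fin 4) := ⊥

/-- `Gs` is a thickening of `G`. -/
def IsThickening {α β : Type*} (Gs : SimpleGraph β) (G : SimpleGraph α) : Prop :=
  ∃ X : α → Set β,
    (∀ v, (X v).Nonempty) ∧
    (∀ u v : α, u ≠ v → Disjoint (X u) (X v)) ∧
    (⋃ v, X v) = Set.univ ∧
    (∀ v, Gs.IsClique (X v)) ∧
    (∀ u v : α, u ≠ v →
      (G.Adj u v → Complete Gs (X u) (X v)) ∧ (¬ G.Adj u v → Anticomplete Gs (X u) (X v)))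

/-- The closed neighborhoods of the vertices of `S` form a chain under inclusion;
equivalently (for finite graphs), `S` can be ordered as `a_1, …, a_r` with
`N_G[a_r] ⊆ ⋯ ⊆ N_G[a_1]`. -/
def ChainClosedNbhd (G : SimpleGraph V) (S : Set V) : Prop :=
  ∀ a ∈ S, ∀ b ∈ S, closedNbhd G a ⊆ closedNbhd G b ∨ closedNbhd G b ⊆ closedNbhd G a

/-- `A` can be partitioned into cliques, pairwise anticomplete to each other. -/
def CliquesPartition (G : SimpleGraph V) (A : Set V) : Prop :=
  ∃ (ℓ : ℕ) (P : Fin ℓ → Set V),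
    (∀ i, G.IsClique (P i)) ∧
    (∀ i j, i ≠ j → Disjoint (P i) (P j)) ∧
    (∀ i j, i ≠ j → Anticomplete G (P i) (P j)) ∧
    (⋃ i, P i) = A

/-- `A` can be partitioned into nonempty cliques, pairwise anticomplete to each other. -/
def NonemptyCliquesPartition (G : SimpleGraph V) (A : Set V) : Prop :=
  ∃ (ℓ : ℕ) (P : Fin ℓ → Set V),
    (∀ i, (P i).Nonempty) ∧
    (∀ i, G.IsClique (P i)) ∧
    (∀ i j, i ≠ j → Disjoint (P i) (P j)) ∧
    (∀ i j, i ≠ j → Anticomplete G (P i) (P j)) ∧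
    (⋃ i, P i) = A

/-- `A` can be partitioned into nonempty cliques, pairwise anticomplete to each other,
each of which can be ordered so that the closed neighborhoods form a decreasing chain. -/
def OrderedCliquesPartition (G : SimpleGraph V) (A : Set V) : Prop :=
  ∃ (ℓ : ℕ) (P : Fin ℓ → Set V),
    (∀ i, (P i).Nonempty) ∧
    (∀ i, G.IsClique (P i)) ∧
    (∀ i j, i ≠ j → Disjoint (P i) (P j)) ∧
    (∀ i j, i ≠ j → Anticomplete G (P i) (P j)) ∧
    (⋃ i, P i) = A ∧
    (∀ i, ChainClosedNbhd G (P i))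

/-- `(X_0,…,X_6; Y_0,…,Y_6; Z_0,…,Z_6; W)` is a special partition of the induced
subgraph of `G` on `S` (indices in `ℤ_7`). -/
def IsSpecialPartitionOn (G : SimpleGraph V) (S : Set V)
    (X Y Z : ZMod 7 → Set V) (W : Set V) : Prop :=
  -- the sets are pairwise disjoint and their union is `S`
  (∀ i j, i ≠ j → Disjoint (X i) (X j)) ∧
  (∀ i j, i ≠ j → Disjoint (Y i) (Y j)) ∧
  (∀ i j, i ≠ j → Disjoint (Z i) (Z j)) ∧
  (∀ i j, Disjoint (X i) (Y j)) ∧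
  (∀ i j, Disjoint (X i) (Z j)) ∧
  (∀ i j, Disjoint (Y i) (Z j)) ∧
  (∀ i, Disjoint (X i) W) ∧ (∀ i, Disjoint (Y i) W) ∧ (∀ i, Disjoint (Z i) W) ∧
  ((⋃ i, X i) ∪ (⋃ i, Y i) ∪ (⋃ i, Z i) ∪ W = S) ∧
  -- all the sets are cliques
  (∀ i, G.IsClique (X i)) ∧ (∀ i, G.IsClique (Y i)) ∧ (∀ i, G.IsClique (Z i)) ∧
  G.IsClique W ∧
  -- (a)
  (∀ i, (X i).Nonempty) ∧
  -- (b)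
  (∀ i, Complete G (X i) (X (i - 1)) ∧ Complete G (X i) (X (i + 1)) ∧
    Anticomplete G (X i) (X (i + 2)) ∧ Anticomplete G (X i) (X (i + 3)) ∧
    Anticomplete G (X i) (X (i + 4)) ∧ Anticomplete G (X i) (X (i + 5))) ∧
  -- (c)
  (∀ i, Complete G (X i) (Y i) ∧ Complete G (X i) (Y (i + 3)) ∧
    Complete G (X i) (Y (i + 6)) ∧ Complete G (X i) (Z i) ∧
    Complete G (X i) (Z (i + 3)) ∧ Complete G (X i) (Z (i + 4)) ∧
    Complete G (X i) (Z (i + 5)) ∧ Complete G (X i) (Z (i + 6)) ∧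
    Complete G (X i) W ∧
    Anticomplete G (X i) (Y (i + 1)) ∧ Anticomplete G (X i) (Y (i + 2)) ∧
    Anticomplete G (X i) (Y (i + 4)) ∧ Anticomplete G (X i) (Y (i + 5)) ∧
    Anticomplete G (X i) (Z (i + 1)) ∧ Anticomplete G (X i) (Z (i + 2))) ∧
  -- (d)
  (∀ i, (Y i).Nonempty →
    (Y (i + 1) = ∅ ∧ Y (i + 2) = ∅ ∧ Y (i + 5) = ∅ ∧ Y (i + 6) = ∅ ∧
      Z (i + 5) = ∅ ∧ Z (i + 6) = ∅) ∧ (Y (i + 3) = ∅ ∨ Y (i + 4) = ∅)) ∧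
  -- (e)
  (∀ i, (Z i).Nonempty → Z (i + 2) = ∅ ∧ Z (i + 5) = ∅) ∧
  -- (f)
  (∀ i, Complete G (Y i) (Y (i + 3)) ∧ Complete G (Y i) (Y (i + 4)) ∧
    Complete G (Y i) (Z i) ∧ Complete G (Y i) (Z (i + 1)) ∧
    Complete G (Y i) (Z (i + 3)) ∧ Complete G (Y i) (Z (i + 4)) ∧
    Complete G (Y i) W ∧ Anticomplete G (Y i) (Z (i + 2))) ∧
  -- (g)
  (∀ i, Complete G (Z i) (Z (i + 1)) ∧ Complete G (Z i) (Z (i + 3)) ∧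
    Complete G (Z i) (Z (i + 4)) ∧ Complete G (Z i) (Z (i + 6)) ∧ Complete G (Z i) W)

/-- `G` admits a special partition. -/
def AdmitsSpecialPartition (G : SimpleGraph V) : Prop :=
  ∃ (X Y Z : ZMod 7 → Set V) (W : Set V), IsSpecialPartitionOn G Set.univ X Y Z W

/-- `G` is a 7-saucer. -/
def IsSevenSaucer (G : SimpleGraph V) : Prop :=
  ∃ (X Y Z : ZMod 7 → Set V) (W A : Set V),
    IsSpecialPartitionOn G Aᶜ X Y Z W ∧
    (∀ i, Anticomplete G A (X i)) ∧
    (∀ i, Anticomplete G A (Y i) ∨ Z (i + 2) = ∅) ∧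
    (A = ∅ ∨ OrderedCliquesPartition G A)
/-- The graph `M_0`: vertices `0,…,6` are `x_0,…,x_6` (a 7-cycle), `7 = y_0`,
`8 = y_3`, `9 = z_0`, `10 = z_3`, `11 = z_4`. -/
def M0 : SimpleGraph (Fin 12) :=
  SimpleGraph.fromRel fun a b => (a, b) ∈
    ([(0,1),(1,2),(2,3),(3,4),(4,5),(5,6),(6,0),
      (7,0),(7,1),(7,4),
      (8,3),(8,4),(8,0),
      (9,0),(9,1),(9,2),(9,3),(9,4),
      (10,3),(10,4),(10,5),(10,6),(10,0),
      (11,4),(11,5),(11,6),(11,0),(11,1),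
      (7,8),(7,9),(7,10),(7,11),(8,9),(8,10),(8,11),(9,10),(9,11),(10,11)] :
      List (Fin 12 × Fin 12))

/-- The graph `M_1`: vertices `0,…,6` are `x_0,…,x_6` (a 7-cycle), `7 = y_0`, `8 = z_2`. -/
def M1 : SimpleGraph (Fin 9) :=
  SimpleGraph.fromRel fun a b => (a, b) ∈
    ([(0,1),(1,2),(2,3),(3,4),(4,5),(5,6),(6,0),
      (7,0),(7,1),(7,4),
      (8,2),(8,3),(8,4),(8,5),(8,6)] : List (Fin 9 × Fin 9))

/-- The graph `M_2`: `M_1` plus the vertex `9 = z_1`. -/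
def M2 : SimpleGraph (Fin 10) :=
  SimpleGraph.fromRel fun a b => (a, b) ∈
    ([(0,1),(1,2),(2,3),(3,4),(4,5),(5,6),(6,0),
      (7,0),(7,1),(7,4),
      (8,2),(8,3),(8,4),(8,5),(8,6),
      (9,1),(9,2),(9,3),(9,4),(9,5),(9,7),(9,8)] : List (Fin 10 × Fin 10))

/-- The graph `M_3`: `M_1` plus the vertex `9 = z_3`. -/
def M3 : SimpleGraph (Fin 10) :=
  SimpleGraph.fromRel fun a b => (a, b) ∈
    ([(0,1),(1,2),(2,3),(3,4),(4,5),(5,6),(6,0),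
      (7,0),(7,1),(7,4),
      (8,2),(8,3),(8,4),(8,5),(8,6),
      (9,3),(9,4),(9,5),(9,6),(9,0),(9,7),(9,8)] : List (Fin 10 × Fin 10))

/-- The set `{y_0, y_3, z_0, z_3, z_4}` of vertices of `M_0`. -/
def M0Extra : Set (Fin 12) := {7, 8, 9, 10, 11}

/-- `H` is a thickening of a graph in the family `ℳ`, which consists of
`M_1`, `M_2`, `M_3`, and all graphs `M_0 - S` for `S ⊆ {y_0,y_3,z_0,z_3,z_4}`. -/
def IsThickeningOfM {β : Type*} (H : SimpleGraph β) : Prop :=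
  IsThickening H M1 ∨ IsThickening H M2 ∨ IsThickening H M3 ∨
  ∃ S : Set (Fin 12), S ⊆ M0Extra ∧ IsThickening H (M0.induce Sᶜ)
/-- The graph `T_0`: vertices `0 = a_0`, `1 = a_1`, `2 = b_0`, `3 = b_1`, `4 = b_2`,
`5 = b_3`, `6 = c_1`, `7 = c_2`, `8 = c_3`. -/
def T0 : SimpleGraph (Fin 9) :=
  SimpleGraph.fromRel fun a b => (a, b) ∈
    ([(0,1),(0,2),(0,4),(0,5),(1,3),(1,4),(1,5),
      (2,6),(3,6),(4,7),(5,8),(6,7),(6,8),(7,8)] : List (Fin 9 × Fin 9))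

/-- The graph `T_1`: `T_0` plus the vertex `9 = f_3`, adjacent to
`a_0,a_1,b_0,b_1,b_2,c_1,c_2` and nonadjacent to `b_3,c_3`. -/
def T1 : SimpleGraph (Fin 10) :=
  SimpleGraph.fromRel fun a b => (a, b) ∈
    ([(0,1),(0,2),(0,4),(0,5),(1,3),(1,4),(1,5),
      (2,6),(3,6),(4,7),(5,8),(6,7),(6,8),(7,8),
      (9,0),(9,1),(9,2),(9,3),(9,4),(9,6),(9,7)] : List (Fin 10 × Fin 10))
/-- `(A_0,A_1;B_0,B_1,B_2,B_3;C_1,C_2,C_3;F_2,F_3;W;Y;Z)` is a tent partition of `G`. -/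
def IsTentPartition (G : SimpleGraph V)
    (A0 A1 B0 B1 B2 B3 C1 C2 C3 F2 F3 W Y Z : Set V) : Prop :=
  let P : Fin 14 → Set V := ![A0, A1, B0, B1, B2, B3, C1, C2, C3, F2, F3, W, Y, Z]
  -- the fourteen sets form a partition of the vertex set
  (∀ i j : Fin 14, i ≠ j → Disjoint (P i) (P j)) ∧
  (⋃ i, P i) = Set.univ ∧
  -- A_0,A_1,B_0,B_1,B_2,B_3,C_1,C_2,C_3 are nonempty cliques
  (A0.Nonempty ∧ A1.Nonempty ∧ B0.Nonempty ∧ B1.Nonempty ∧ B2.Nonempty ∧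
    B3.Nonempty ∧ C1.Nonempty ∧ C2.Nonempty ∧ C3.Nonempty) ∧
  (G.IsClique A0 ∧ G.IsClique A1 ∧ G.IsClique B0 ∧ G.IsClique B1 ∧ G.IsClique B2 ∧
    G.IsClique B3 ∧ G.IsClique C1 ∧ G.IsClique C2 ∧ G.IsClique C3) ∧
  -- F_2, F_3, Y are cliques, and at most one of them is nonempty
  (G.IsClique F2 ∧ G.IsClique F3 ∧ G.IsClique Y) ∧
  ((F2 = ∅ ∧ F3 = ∅) ∨ (F2 = ∅ ∧ Y = ∅) ∨ (F3 = ∅ ∧ Y = ∅)) ∧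
  -- W is a (possibly empty) clique
  G.IsClique W ∧
  Complete G A0 A1 ∧
  (Complete G A0 B0 ∧ Complete G A0 B2 ∧ Complete G A0 B3 ∧
    Anticomplete G A0 B1 ∧ Anticomplete G A0 C1 ∧ Anticomplete G A0 C2 ∧
    Anticomplete G A0 C3) ∧
  (Complete G A1 B1 ∧ Complete G A1 B2 ∧ Complete G A1 B3 ∧
    Anticomplete G A1 B0 ∧ Anticomplete G A1 C1 ∧ Anticomplete G A1 C2 ∧
    Anticomplete G A1 C3) ∧
  (Anticomplete G B0 B1 ∧ Anticomplete G B0 B2 ∧ Anticomplete G B0 B3 ∧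
    Anticomplete G B1 B2 ∧ Anticomplete G B1 B3 ∧ Anticomplete G B2 B3) ∧
  (Complete G C1 C2 ∧ Complete G C1 C3 ∧ Complete G C2 C3) ∧
  (Complete G C1 B0 ∧ Complete G C1 B1 ∧ Anticomplete G C1 B2 ∧ Anticomplete G C1 B3) ∧
  (Complete G C2 B2 ∧ Anticomplete G C2 B0 ∧ Anticomplete G C2 B1 ∧
    Anticomplete G C2 B3) ∧
  (Complete G C3 B3 ∧ Anticomplete G C3 B0 ∧ Anticomplete G C3 B1 ∧
    Anticomplete G C3 B2) ∧
  (Complete G F2 A0 ∧ Complete G F2 A1 ∧ Complete G F2 B0 ∧ Complete G F2 B1 ∧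
    Complete G F2 B3 ∧ Complete G F2 C1 ∧ Complete G F2 C3 ∧
    Anticomplete G F2 B2 ∧ Anticomplete G F2 C2) ∧
  (Complete G F3 A0 ∧ Complete G F3 A1 ∧ Complete G F3 B0 ∧ Complete G F3 B1 ∧
    Complete G F3 B2 ∧ Complete G F3 C1 ∧ Complete G F3 C2 ∧
    Anticomplete G F3 B3 ∧ Anticomplete G F3 C3) ∧
  (Complete G W A0 ∧ Complete G W A1 ∧ Complete G W B0 ∧ Complete G W B1 ∧
    Complete G W B2 ∧ Complete G W B3 ∧ Complete G W C1 ∧ Complete G W C2 ∧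
    Complete G W C3 ∧ Complete G W F2 ∧ Complete G W F3) ∧
  (Complete G Y C2 ∧ Complete G Y C3 ∧
    Anticomplete G Y A0 ∧ Anticomplete G Y A1 ∧ Anticomplete G Y B0 ∧
    Anticomplete G Y B1 ∧ Anticomplete G Y B2 ∧ Anticomplete G Y B3 ∧
    Anticomplete G Y C1) ∧
  (Anticomplete G Z A0 ∧ Anticomplete G Z A1 ∧ Anticomplete G Z B0 ∧
    Anticomplete G Z B1 ∧ Anticomplete G Z B2 ∧ Anticomplete G Z B3 ∧
    Anticomplete G Z C1 ∧ Anticomplete G Z C2 ∧ Anticomplete G Z C3 ∧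
    Anticomplete G Z Y) ∧
  -- Y can be ordered so that the closed neighborhoods form a chain
  ChainClosedNbhd G Y ∧
  -- Z is empty or can be partitioned into nonempty cliques, pairwise anticomplete,
  -- each ordered so that the closed neighborhoods form a chain
  (Z = ∅ ∨ OrderedCliquesPartition G Z)

/-- `G` is a tent. -/
def IsTent (G : SimpleGraph V) : Prop :=
  ∃ A0 A1 B0 B1 B2 B3 C1 C2 C3 F2 F3 W Y Z : Set V,
    IsTentPartition G A0 A1 B0 B1 B2 B3 C1 C2 C3 F2 F3 W Y Z

/-- The reflexive closure of adjacency, as a Boolean relation. -/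
noncomputable def rel (G : SimpleGraph V) (u v : V) : Bool :=
  open Classical in decide (u = v ∨ G.Adj u v)

/-- `a, b, c, d` are the consecutive vertices of an induced `C_4`,
where `R` is the reflexive closure of adjacency. -/
def isC4 {α : Type*} (R : α → α → Bool) (a b c d : α) : Bool :=
  R a b && R b c && R c d && R a d && !R a c && !R b d

/-- `a, b, c, d, e, f` are the consecutive vertices of an induced `C_6`. -/
def isC6 {α : Type*} (R : α → α → Bool) (a b c d e f : α) : Bool :=
  R a b && R b c && R c d && R d e && R e f && R a f &&
  !R a c && !R a d && !R a e && !R b d && !R b e && !R b f && !R c e && !R c f && !R d f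

/-- `a, b, c` and `d, e, f` are the consecutive vertices of the two paths of an induced `2P_3`. -/
def isTwoP3 {α : Type*} (R : α → α → Bool) (a b c d e f : α) : Bool :=
  R a b && R b c && R d e && R e f && !R a c && !R d f &&
  !R a d && !R a e && !R a f && !R b d && !R b e && !R b f && !R c d && !R c e && !R c f

/-- Five kinds of classes, encoded as natural numbers: `X_i` is `i`, `Y_i` is `7 + i`,
`Z_i` is `14 + i`, `W` is `21` and `A` is `28`. -/
def labels : List ℕ := List.range 22 ++ [28]

/-- The set of differences `j - i` for which vertices of the `i`-th class of the first kind and the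
`j`-th class of the second kind may be (non)adjacent, as a bit mask. -/
def mask : Bool → ℕ → ℕ → ℕ
  | true, 0, 0 => 67
  | true, 0, 1 => 73
  | true, 0, 2 => 121
  | true, 0, 4 => 0
  | true, 1, 1 => 25
  | true, 1, 2 => 27
  | true, 2, 2 => 91
  | true, _, _ => 127
  | false, 0, 0 => 60
  | false, 0, 1 => 54
  | false, 0, 2 => 6
  | false, 1, 1 => 0
  | false, 1, 2 => 4
  | false, 2, 2 => 0
  | false, _, 3 => 0
  | false, _, _ => 127

/-- `ok l m e`: in a 7-saucer, there may be vertices `u ≠ v` with labels `l` and `m` whose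
adjacency is `e`. -/
def ok (l m : ℕ) (e : Bool) : Bool :=
  if l / 7 ≤ m / 7 then (mask e (l / 7) (m / 7)).testBit ((m % 7 + 7 - l % 7) % 7)
  else (mask e (m / 7) (l / 7)).testBit ((l % 7 + 7 - m % 7) % 7)

/-- The seven-cycle on `0, …, 6` together with the vertex `7`, whose neighbors on the
cycle are given by `p`, and the vertex `8`, whose neighbors on the cycle are given by `q`. -/
def cyclePlusTwo (p q : ℕ → Bool) (e : Bool) (a b : ℕ) : Bool :=
  if a < 7 then (if b < 7 then ok a b true else if b = 7 then p a else q a)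
  else if b < 7 then (if a = 7 then p b else q b)
  else if a = 7 then (if b = 7 then true else e)
  else (if b = 7 then e else true)

/-- One of fourteen specific obstructions on the vertices `g 0, …, g 8` is present. -/
def obstructedBy (R : ℕ → ℕ → Bool) (g : ℕ → ℕ) : Bool :=
  isC4 R (g 0) (g 1) (g 7) (g 8) ||
  isC4 R (g 0) (g 7) (g 3) (g 8) ||
  isC4 R (g 0) (g 1) (g 2) (g 7) ||
  isC4 R (g 0) (g 7) (g 2) (g 8) ||
  isC6 R (g 0) (g 1) (g 2) (g 7) (g 4) (g 8) ||
  isC6 R (g 0) (g 1) (g 2) (g 7) (g 5) (g 8) ||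
  isTwoP3 R (g 0) (g 1) (g 2) (g 5) (g 4) (g 7) ||
  isC6 R (g 0) (g 1) (g 2) (g 3) (g 4) (g 7) ||
  isTwoP3 R (g 0) (g 1) (g 2) (g 7) (g 4) (g 8) ||
  isC6 R (g 0) (g 1) (g 2) (g 3) (g 7) (g 8) ||
  isTwoP3 R (g 0) (g 1) (g 7) (g 3) (g 4) (g 8) ||
  isTwoP3 R (g 0) (g 1) (g 2) (g 5) (g 7) (g 8) ||
  isTwoP3 R (g 0) (g 1) (g 7) (g 4) (g 3) (g 8) ||
  isC6 R (g 0) (g 1) (g 7) (g 4) (g 3) (g 8)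

/-- One of the fourteen obstructions is present up to a rotation of the seven-cycle and
an exchange of the two additional vertices. -/
def obstructed (R : ℕ → ℕ → Bool) : Bool :=
  (List.range 7).any fun r =>
    obstructedBy R (fun x => if x < 7 then (x + r) % 7 else x) ||
    obstructedBy R (fun x => if x < 7 then (x + r) % 7 else 15 - x)

theorem exists_label_or_obstructed : ∀ s < 128,
    (∃ l ∈ labels, ∀ j < 7, ok l j (s.testBit j) = true) ∨
      obstructed (cyclePlusTwo s.testBit s.testBit true) = true := by
  decide +kernel

theorem ok_or_obstructed : ∀ l ∈ labels, ∀ m ∈ labels, ∀ e,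
    ok l m e = true ∨ obstructed (cyclePlusTwo (ok l · true) (ok m · true) e) = true := by
  decide +kernel

theorem eq_ok : ∀ l ∈ labels, ∀ j < 7, ∀ e, ok l j e = true → e = ok l j true := by
  decide +kernel

theorem label_unique : ∀ l ∈ labels, ∀ m ∈ labels,
    (∀ j < 7, ok l j true = ok m j true) → l = m := by
  decide +kernel

theorem not_isC4_labels : ∀ a : Fin 22, ∀ b : Fin 22, ok a b true = true →
    ∀ c : Fin 22, ok b c true = true → ok a c false = true →
    ∀ d : Fin 22, ok c d true = true → ok a d true = true → ok b d false = false := by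
  decide +kernel

theorem not_isC6_labels : ∀ a : Fin 22, ∀ b : Fin 22, ok a b true = true →
    ∀ c : Fin 22, ok b c true = true → ok a c false = true →
    ∀ d : Fin 22, ok c d true = true → ok b d false = true → ok a d false = true →
    ∀ e : Fin 22, ok d e true = true → ok c e false = true → ok b e false = true →
      ok a e false = true →
    ∀ f : Fin 22, ok e f true = true → ok a f true = true → ok b f false = true →
      ok c f false = true → ok d f false = false := by
  decide +kernel

theorem not_isTwoP3_labels : ∀ a : Fin 22, ∀ b : Fin 22, ok a b true = true →
    ∀ c : Fin 22, ok b c true = true → ok a c false = true →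
    ∀ d : Fin 22, ok a d false = true → ok b d false = true → ok c d false = true →
    ∀ e : Fin 22, ok d e true = true → ok a e false = true → ok b e false = true →
      ok c e false = true →
    ∀ f : Fin 22, ok e f true = true → ok d f false = true → ok a f false = true →
      ok b f false = true → ok c f false = false := by
  decide +kernel

/-- `k` and `l` are the labels of some `Y_i` and of `Z_{i+2}`. -/
def isFar (k l : ℕ) : Bool := k / 7 = 1 && l = 14 + (k + 2) % 7

theorem isFar_of_ok : ∀ k : Fin 22, 7 ≤ k.val → ∀ l : Fin 22, 7 ≤ l.val → ok k l false = true →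
    isFar k l = true ∨ isFar l k = true := by
  decide +kernel

theorem not_path_labels : ∀ k : Fin 22, 7 ≤ k.val →
    ∀ a : Fin 22, ok k a false = true → isFar k a = false →
    ∀ b : Fin 22, ok k b false = true → isFar k b = false → ok a b true = true →
    ∀ c : Fin 22, ok k c false = true → isFar k c = false → ok b c true = true →
      ok a c false = false := by
  decide +kernel

theorem isFar_witnesses : ∀ k ∈ labels, ∀ l ∈ labels, isFar k l = true →
    ok k l true = false ∧ ∃ p < 7, ∃ q < 7, ∃ r < 7, ∃ s < 7,
      ok k p true = true ∧ ok l p true = true ∧ ok k q true = true ∧ ok l q true = false ∧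
      ok k r true = false ∧ ok l r true = true ∧ ok k s true = false ∧ ok l s true = true ∧
      ok q r true = false ∧ ok q s true = false ∧ ok r s true = false := by
  decide +kernel

theorem label_cases : ∀ k ∈ labels, ok 28 k true = true → k = 28 ∨ k < 22 ∧ 7 ≤ k := by
  decide +kernel

theorem mem_labels_of_lt : ∀ i < 7, i ∈ labels := by
  decide +kernel

theorem rel_self (G : SimpleGraph V) (u : V) : rel G u u = true := by simp [rel]

theorem rel_comm (G : SimpleGraph V) (u v : V) : rel G u v = rel G v u := by
  simp [rel, eq_comm, G.adj_comm]

theorem adj_of_rel {G : SimpleGraph V} {u v : V} (h : rel G u v = true) (hne : u ≠ v) :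
    G.Adj u v := by
  simpa [rel, hne] using h

theorem rel_of_adj {G : SimpleGraph V} {u v : V} (h : G.Adj u v) : rel G u v = true := by
  simp [rel, h]

theorem rel_eq_false {G : SimpleGraph V} {u v : V} (hne : u ≠ v) (h : ¬ G.Adj u v) :
    rel G u v = false := by
  simp [rel, h, hne]

theorem mem_closedNbhd_iff {G : SimpleGraph V} {u v : V} :
    v ∈ closedNbhd G u ↔ rel G u v = true := by
  simp [closedNbhd, rel, eq_comm]

/-- If no two vertices of `H` are true twins, then an induced copy of `H` is the same thing as
a map preserving the reflexive closure of adjacency in both directions. -/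
theorem containsInduced_iff_rel {n : ℕ} (G : SimpleGraph V) (H : SimpleGraph (Fin n))
    [DecidableRel H.Adj]
    (hH : ∀ a b, (∀ c, decide (a = c ∨ H.Adj a c) = decide (b = c ∨ H.Adj b c)) → a = b) :
    ContainsInduced G H ↔
      ∃ f : Fin n → V, ∀ a b, rel G (f a) (f b) = decide (a = b ∨ H.Adj a b) := by
  constructor
  · rintro ⟨s, ⟨e⟩⟩
    refine ⟨fun a => (e a).1, fun a b => ?_⟩
    have : H.Adj a b ↔ G.Adj (e a).1 (e b).1 := by
      rw [← e.map_adj_iff]; rfl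
    simp only [rel, ← this, Subtype.val_inj, e.injective.eq_iff]
  · rintro ⟨f, hf⟩
    have hinj : Function.Injective f := by
      intro a b hab
      apply hH
      intro c
      rw [← hf, ← hf, hab]
    have hadj : ∀ {a b}, G.Adj (f a) (f b) ↔ H.Adj a b := by
      intro a b
      by_cases hab : a = b
      · subst hab; simp
      · have := hf a b
        simpa [rel, hab, hinj.eq_iff] using this
    exact ⟨_, ⟨SimpleGraph.Embedding.isoInduceRange ⟨⟨f, hinj⟩, hadj⟩⟩⟩

instance : DecidableRel twoP3.Adj := by
  unfold twoP3; infer_instance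

theorem containsInduced_c4_iff (G : SimpleGraph V) :
    ContainsInduced G (cycleGraph 4) ↔ ∃ a b c d, isC4 (rel G) a b c d = true := by
  rw [containsInduced_iff_rel _ _ (by decide +kernel)]
  constructor
  · rintro ⟨f, hf⟩
    refine ⟨f 0, f 1, f 2, f 3, ?_⟩
    simp only [isC4, hf]
    decide +kernel
  · rintro ⟨a, b, c, d, h⟩
    simp only [isC4, Bool.and_eq_true, Bool.not_eq_true', and_assoc] at h
    refine ⟨![a, b, c, d], fun i j => ?_⟩
    have h' := rel_comm G
    fin_cases i <;> fin_cases j <;> simp [rel_self, h, h' _ a, h' _ b, h' d c] <;> decide +kernel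

theorem containsInduced_c6_iff (G : SimpleGraph V) :
    ContainsInduced G (cycleGraph 6) ↔ ∃ a b c d e f, isC6 (rel G) a b c d e f = true := by
  rw [containsInduced_iff_rel _ _ (by decide +kernel)]
  constructor
  · rintro ⟨f, hf⟩
    refine ⟨f 0, f 1, f 2, f 3, f 4, f 5, ?_⟩
    simp only [isC6, hf]
    decide +kernel
  · rintro ⟨a, b, c, d, e, f, h⟩
    simp only [isC6, Bool.and_eq_true, Bool.not_eq_true', and_assoc] at h
    refine ⟨![a, b, c, d, e, f], fun i j => ?_⟩
    have h' := rel_comm G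
    fin_cases i <;> fin_cases j <;>
      simp [rel_self, h, h' _ a, h' _ b, h' d c, h' e c, h' f c, h' e d, h' f d, h' f e] <;>
      decide +kernel

theorem containsInduced_twoP3_iff (G : SimpleGraph V) :
    ContainsInduced G twoP3 ↔ ∃ a b c d e f, isTwoP3 (rel G) a b c d e f = true := by
  rw [containsInduced_iff_rel _ _ (by decide +kernel)]
  constructor
  · rintro ⟨f, hf⟩
    refine ⟨f 0, f 1, f 2, f 3, f 4, f 5, ?_⟩
    simp only [isTwoP3, hf]
    decide +kernel
  · rintro ⟨a, b, c, d, e, f, h⟩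
    simp only [isTwoP3, Bool.and_eq_true, Bool.not_eq_true', and_assoc] at h
    refine ⟨![a, b, c, d, e, f], fun i j => ?_⟩
    have h' := rel_comm G
    fin_cases i <;> fin_cases j <;>
      simp [rel_self, h, h' _ a, h' _ b, h' d c, h' e c, h' f c, h' e d, h' f d, h' f e] <;>
      decide +kernel

theorem containsInduced_c7_iff (G : SimpleGraph V) :
    ContainsInduced G (cycleGraph 7) ↔
      ∃ x : ℕ → V, ∀ i < 7, ∀ j < 7, rel G (x i) (x j) = ok i j true := by
  have key : ∀ i j : Fin 7, decide (i = j ∨ (cycleGraph 7).Adj i j) = ok i j true := by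
    decide +kernel
  rw [containsInduced_iff_rel _ _ (by decide +kernel)]
  constructor
  · rintro ⟨f, hf⟩
    refine ⟨fun i => f (Fin.ofNat 7 i), fun i hi j hj => ?_⟩
    rw [hf, key]
    simp [Nat.mod_eq_of_lt hi, Nat.mod_eq_of_lt hj]
  · rintro ⟨x, hx⟩
    exact ⟨fun i => x i, fun i j => by rw [hx i i.2 j j.2, key]⟩

/-- The labels of the vertices describe the partition of a 7-saucer. -/
structure SaucerLabeling (G : SimpleGraph V) (lab : V → ℕ) : Prop where
  mem_labels : ∀ v, lab v ∈ labels
  exists_eq : ∀ i < 7, ∃ v, lab v = i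
  ok_rel : ∀ u v, ok (lab u) (lab v) (rel G u v) = true
  rel_eq_false_of_isFar : ∀ a y z, lab a = 28 → isFar (lab y) (lab z) = true → rel G a y = false
  rel_trans : ∀ a b c, lab a = 28 → lab b = 28 → lab c = 28 →
    rel G a b = true → rel G b c = true → rel G a c = true
  chain : ∀ a b, lab a = 28 → lab b = 28 → rel G a b = true →
    (∀ p, rel G a p = true → rel G b p = true) ∨ (∀ p, rel G b p = true → rel G a p = true)

section Forward

variable {G : SimpleGraph V} {x : ℕ → V}

/-- No vertices of `G` induce a `C_4`, a `C_6` or a `2P_3`. -/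
structure Unobstructed (G : SimpleGraph V) : Prop where
  c4 : ∀ a b c d, isC4 (rel G) a b c d = false
  c6 : ∀ a b c d e f, isC6 (rel G) a b c d e f = false
  twoP3 : ∀ a b c d e f, isTwoP3 (rel G) a b c d e f = false

theorem unobstructed_iff (G : SimpleGraph V) :
    Unobstructed G ↔ HFree G twoP3 ∧ HFree G (cycleGraph 4) ∧ HFree G (cycleGraph 6) := by
  simp only [HFree, containsInduced_c4_iff, containsInduced_c6_iff, containsInduced_twoP3_iff,
    not_exists, Bool.not_eq_true]
  exact ⟨fun h => ⟨h.twoP3, h.c4, h.c6⟩, fun h => ⟨h.2.1, h.2.2, h.1⟩⟩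

theorem Unobstructed.obstructed_eq_false (hG : Unobstructed G) (c : ℕ → V) :
    obstructed (fun a b => rel G (c a) (c b)) = false := by
  have h4 : ∀ a b d e, isC4 (fun a b => rel G (c a) (c b)) a b d e = false :=
    fun _ _ _ _ => hG.c4 _ _ _ _
  have h6 : ∀ a b d e f g, isC6 (fun a b => rel G (c a) (c b)) a b d e f g = false :=
    fun _ _ _ _ _ _ => hG.c6 _ _ _ _ _ _
  have hP : ∀ a b d e f g, isTwoP3 (fun a b => rel G (c a) (c b)) a b d e f g = false :=
    fun _ _ _ _ _ _ => hG.twoP3 _ _ _ _ _ _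
  simp [obstructed, obstructedBy, h4, h6, hP]

theorem Unobstructed.cyclePlusTwo_eq_false (hG : Unobstructed G)
    (hx : ∀ i < 7, ∀ j < 7, rel G (x i) (x j) = ok i j true) {u v : V} {p q : ℕ → Bool}
    (hp : ∀ j < 7, rel G u (x j) = p j) (hq : ∀ j < 7, rel G v (x j) = q j) :
    obstructed (cyclePlusTwo p q (rel G u v)) = false := by
  rw [← hG.obstructed_eq_false (fun a => if a < 7 then x a else if a = 7 then u else v)]
  congr 1
  funext a b
  unfold cyclePlusTwo
  have hc := rel_comm G
  have hs := rel_self G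
  split_ifs <;> simp_all

/-- `l` is the label of `v` with respect to the seven-cycle `x 0, …, x 6`. -/
def IsLabel (G : SimpleGraph V) (x : ℕ → V) (v : V) (l : ℕ) : Prop :=
  l ∈ labels ∧ ∀ j < 7, rel G v (x j) = ok l j true

theorem Unobstructed.exists_isLabel (hG : Unobstructed G)
    (hx : ∀ i < 7, ∀ j < 7, rel G (x i) (x j) = ok i j true) (v : V) :
    ∃ l, IsLabel G x v l := by
  have hs : ∀ j < 7, rel G v (x j) = (Nat.ofBits fun j : Fin 7 => rel G v (x j)).testBit j :=
    fun j hj => by rw [Nat.testBit_ofBits_lt _ _ hj]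
  rcases exists_label_or_obstructed _ (Nat.ofBits_lt_two_pow fun j : Fin 7 => rel G v (x j)) with
    ⟨l, hl, h⟩ | h
  · exact ⟨l, hl, fun j hj => by rw [hs j hj]; exact eq_ok l hl j hj _ (h j hj)⟩
  · have := hG.cyclePlusTwo_eq_false hx hs hs
    rw [rel_self, h] at this
    cases this

theorem IsLabel.unique {v : V} {l m : ℕ} (hl : IsLabel G x v l) (hm : IsLabel G x v m) : l = m :=
  label_unique l hl.1 m hm.1 fun j hj => by rw [← hl.2 j hj, hm.2 j hj]

theorem Unobstructed.ok_of_isLabel (hG : Unobstructed G)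
    (hx : ∀ i < 7, ∀ j < 7, rel G (x i) (x j) = ok i j true) {u v : V} {l m : ℕ}
    (hu : IsLabel G x u l) (hv : IsLabel G x v m) : ok l m (rel G u v) = true := by
  rcases ok_or_obstructed l hu.1 m hv.1 (rel G u v) with h | h
  · exact h
  · rw [hG.cyclePlusTwo_eq_false hx hu.2 hv.2] at h
    cases h

theorem eq_ok_of_isLabel (hG : Unobstructed G)
    (hx : ∀ i < 7, ∀ j < 7, rel G (x i) (x j) = ok i j true) {u v : V} {l m : ℕ}
    (hu : IsLabel G x u l) (hv : IsLabel G x v m) (h : ok l m true = false) :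
    rel G u v = false := by
  have := hG.ok_of_isLabel hx hu hv
  cases h' : rel G u v
  · rfl
  · rw [h', h] at this
    cases this

/-- The vertices with label `28` induce a disjoint union of cliques. -/
theorem Unobstructed.rel_trans (hG : Unobstructed G)
    (hx : ∀ i < 7, ∀ j < 7, rel G (x i) (x j) = ok i j true) {a b c : V}
    (ha : IsLabel G x a 28) (hb : IsLabel G x b 28) (hc : IsLabel G x c 28)
    (hab : rel G a b = true) (hbc : rel G b c = true) : rel G a c = true := by
  by_contra hac
  have h28 : ∀ j < 7, ok 28 j true = false := by decide +kernel
  have h := hG.twoP3 a b c (x 0) (x 1) (x 2)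
  have e1 : ok 0 1 true = true := by decide +kernel
  have e2 : ok 1 2 true = true := by decide +kernel
  have e3 : ok 0 2 true = false := by decide +kernel
  simp [isTwoP3, hab, hbc, hac, ha.2, hb.2, hc.2, hx, h28, e1, e2, e3] at h

/-- A vertex with label `28` does not have a neighbor in `Y_i` if `Z_{i+2}` is nonempty. -/
theorem Unobstructed.rel_eq_false_of_isFar (hG : Unobstructed G)
    (hx : ∀ i < 7, ∀ j < 7, rel G (x i) (x j) = ok i j true) {a y z : V} {k l : ℕ}
    (ha : IsLabel G x a 28) (hy : IsLabel G x y k) (hz : IsLabel G x z l)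
    (hkl : isFar k l = true) : rel G a y = false := by
  have h28 : ∀ j < 7, ok 28 j true = false := by decide +kernel
  obtain ⟨hkl', p, hp, q, hq, r, hr, s, hs, h⟩ := isFar_witnesses k hy.1 l hz.1 hkl
  have hyz := eq_ok_of_isLabel hG hx hy hz hkl'
  by_contra hay
  rw [Bool.not_eq_false] at hay
  cases haz : rel G a z
  · have h2 := hG.twoP3 a y (x q) (x r) z (x s)
    simp [isTwoP3, ha.2, hy.2, hz.2, rel_comm G (x q) z, rel_comm G (x r) z, *] at h2
  · have h4 := hG.c4 a y (x p) z
    simp [isC4, ha.2, hy.2, hz.2, rel_comm G (x p) z, *] at h4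

/-- If `a` and `b` are adjacent vertices with label `28`, then their closed neighborhoods are
comparable. -/
theorem Unobstructed.chain (hG : Unobstructed G)
    (hx : ∀ i < 7, ∀ j < 7, rel G (x i) (x j) = ok i j true) {a b : V}
    (ha : IsLabel G x a 28) (hb : IsLabel G x b 28) (hab : rel G a b = true) :
    (∀ p, rel G a p = true → rel G b p = true) ∨ (∀ p, rel G b p = true → rel G a p = true) := by
  have hba : rel G b a = true := by rw [rel_comm, hab]
  have key : ∀ {c d : V}, IsLabel G x c 28 → IsLabel G x d 28 → rel G d c = true →
      ∀ p, rel G c p = true → ¬ rel G d p = true →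
      ∃ k < 22, 7 ≤ k ∧ IsLabel G x p k := by
    intro c d hc hd hdc p hcp hdp
    obtain ⟨k, hk⟩ := hG.exists_isLabel hx p
    have h1 := hG.ok_of_isLabel hx hc hk
    rw [hcp] at h1
    rcases label_cases k hk.1 h1 with rfl | h
    · exact absurd (hG.rel_trans hx hd hc hk hdc hcp) hdp
    · exact ⟨k, h.1, h.2, hk⟩
  by_contra! h
  obtain ⟨⟨u, hau, hbu⟩, w, hbw, haw⟩ := h
  obtain ⟨k, hk, hk', hku⟩ := key ha hb hba u hau hbu
  obtain ⟨l, hl, hl', hlw⟩ := key hb ha hab w hbw haw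
  cases huw : rel G u w
  · have h1 := hG.ok_of_isLabel hx hku hlw
    rw [huw] at h1
    rcases isFar_of_ok ⟨k, hk⟩ hk' ⟨l, hl⟩ hl' h1 with h | h
    · rw [hG.rel_eq_false_of_isFar hx ha hku hlw h] at hau
      cases hau
    · rw [hG.rel_eq_false_of_isFar hx hb hlw hku h] at hbw
      cases hbw
  · have h4 := hG.c4 a b w u
    simp_all [isC4, rel_comm G w u]

theorem Unobstructed.exists_saucerLabeling (hG : Unobstructed G)
    (hx : ∀ i < 7, ∀ j < 7, rel G (x i) (x j) = ok i j true) :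
    ∃ lab, SaucerLabeling G lab := by
  choose lab hlab using hG.exists_isLabel hx
  have h28 : ∀ {v}, lab v = 28 → IsLabel G x v 28 := fun {v} h => h ▸ hlab v
  refine ⟨lab, fun v => (hlab v).1, fun i hi => ⟨x i, ?_⟩,
    fun u v => hG.ok_of_isLabel hx (hlab u) (hlab v),
    fun a y z ha h => hG.rel_eq_false_of_isFar hx (h28 ha) (hlab y) (hlab z) h,
    fun a b c ha hb hc => hG.rel_trans hx (h28 ha) (h28 hb) (h28 hc),
    fun a b ha hb => hG.chain hx (h28 ha) (h28 hb)⟩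
  exact (hlab (x i)).unique ⟨mem_labels_of_lt i hi, hx i hi⟩

end Forward

namespace SaucerLabeling

variable {G : SimpleGraph V} {lab : V → ℕ}

theorem ok_true (h : SaucerLabeling G lab) {u v : V} (huv : rel G u v = true) :
    ok (lab u) (lab v) true = true := huv ▸ h.ok_rel u v

theorem ok_false (h : SaucerLabeling G lab) {u v : V} (huv : rel G u v = false) :
    ok (lab u) (lab v) false = true := huv ▸ h.ok_rel u v

theorem containsInduced_c7 (h : SaucerLabeling G lab) : ContainsInduced G (cycleGraph 7) := by
  rw [containsInduced_c7_iff]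
  have hx : ∀ i, ∃ v, i < 7 → lab v = i := by
    intro i
    by_cases hi : i < 7
    · exact (h.exists_eq i hi).imp fun v hv _ => hv
    · exact ⟨(h.exists_eq 0 (by decide)).choose, fun hi' => absurd hi' hi⟩
  choose x hx using hx
  refine ⟨x, fun i hi j hj => eq_ok i (mem_labels_of_lt i hi) j hj _ ?_⟩
  have := h.ok_rel (x i) (x j)
  rwa [hx i hi, hx j hj] at this

theorem lt_of_ne (h : SaucerLabeling G lab) {v : V} (hv : lab v ≠ 28) : lab v < 22 := by
  have := h.mem_labels v
  simp only [labels, List.mem_append, List.mem_range, List.mem_singleton] at this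
  tauto

/-- A neighbor of a vertex with label `28` has label `28` or a label in `7, …, 21`. -/
theorem le_of_rel (h : SaucerLabeling G lab) {a v : V} (ha : lab a = 28)
    (hav : rel G a v = true) (hv : lab v ≠ 28) : 7 ≤ lab v := by
  have := h.ok_true hav
  rw [ha] at this
  exact ((label_cases _ (h.mem_labels v) this).resolve_left hv).2

/-- The neighbors of a vertex with label `28` outside the class of label `28` form a clique. -/
theorem rel_of_rel_of_rel (h : SaucerLabeling G lab) {a u v : V} (ha : lab a = 28)
    (hau : rel G a u = true) (hav : rel G a v = true) (hu : lab u ≠ 28) (hv : lab v ≠ 28) :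
    rel G u v = true := by
  by_contra huv
  rw [Bool.not_eq_true] at huv
  rcases isFar_of_ok ⟨_, h.lt_of_ne hu⟩ (h.le_of_rel ha hau hu) ⟨_, h.lt_of_ne hv⟩
    (h.le_of_rel ha hav hv) (h.ok_false huv) with hf | hf
  · have := h.rel_eq_false_of_isFar a u v ha hf
    simp_all
  · have := h.rel_eq_false_of_isFar a v u ha hf
    simp_all

/-- A vertex with label `28` does not lie on an induced cycle of length at least four. -/
theorem ne_of_cycle (h : SaucerLabeling G lab) {a b c e f : V} (hab : rel G a b = true)
    (hbc : rel G b c = true) (haf : rel G a f = true) (hfe : rel G f e = true)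
    (hac : rel G a c = false) (hae : rel G a e = false) (hbf : rel G b f = false) :
    lab a ≠ 28 := by
  intro ha
  have hfb := rel_comm G f b
  by_cases hb : lab b = 28
  · rcases h.chain a b ha hb hab with h' | h'
    · simp [h' f haf] at hbf
    · simp [h' c hbc] at hac
  by_cases hf : lab f = 28
  · rcases h.chain a f ha hf haf with h' | h'
    · simp [← hfb, h' b hab] at hbf
    · simp [h' e hfe] at hae
  simp [h.rel_of_rel_of_rel ha hab haf hb hf] at hbf

theorem not_isC4 (h : SaucerLabeling G lab) (a b c d : V) : isC4 (rel G) a b c d = false := by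
  by_contra hC
  simp only [isC4, Bool.not_eq_false, Bool.and_eq_true, Bool.not_eq_true', and_assoc] at hC
  obtain ⟨hab, hbc, hcd, had, hac, hbd⟩ := hC
  have hba := rel_comm G b a ▸ hab
  have hcb := rel_comm G c b ▸ hbc
  have hdc := rel_comm G d c ▸ hcd
  have hda := rel_comm G d a ▸ had
  have hca := rel_comm G c a ▸ hac
  have hdb := rel_comm G d b ▸ hbd
  have ha := h.lt_of_ne (h.ne_of_cycle hab hbc had hdc hac hac hbd)
  have hb := h.lt_of_ne (h.ne_of_cycle hbc hcd hba had hbd hbd hca)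
  have hc := h.lt_of_ne (h.ne_of_cycle hcd hda hcb hba hca hca hdb)
  have hd := h.lt_of_ne (h.ne_of_cycle hda hab hdc hcb hdb hdb hac)
  have := not_isC4_labels ⟨_, ha⟩ ⟨_, hb⟩ (h.ok_true hab) ⟨_, hc⟩ (h.ok_true hbc)
    (h.ok_false hac) ⟨_, hd⟩ (h.ok_true hcd) (h.ok_true had)
  rw [h.ok_false hbd] at this
  cases this

theorem not_isC6 (h : SaucerLabeling G lab) (a b c d e f : V) :
    isC6 (rel G) a b c d e f = false := by
  by_contra hC
  simp only [isC6, Bool.not_eq_false, Bool.and_eq_true, Bool.not_eq_true', and_assoc] at hC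
  obtain ⟨hab, hbc, hcd, hde, hef, haf, hac, had, hae, hbd, hbe, hbf, hce, hcf, hdf⟩ := hC
  have hba := rel_comm G b a ▸ hab
  have hcb := rel_comm G c b ▸ hbc
  have hdc := rel_comm G d c ▸ hcd
  have hed := rel_comm G e d ▸ hde
  have hfe := rel_comm G f e ▸ hef
  have hfa := rel_comm G f a ▸ haf
  have hca := rel_comm G c a ▸ hac
  have hdb := rel_comm G d b ▸ hbd
  have hec := rel_comm G e c ▸ hce
  have hfd := rel_comm G f d ▸ hdf
  have hea := rel_comm G e a ▸ hae
  have hfb := rel_comm G f b ▸ hbf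
  have ha := h.lt_of_ne (h.ne_of_cycle hab hbc haf hfe hac hae hbf)
  have hb := h.lt_of_ne (h.ne_of_cycle hbc hcd hba haf hbd hbf hca)
  have hc := h.lt_of_ne (h.ne_of_cycle hcd hde hcb hba hce hca hdb)
  have hd := h.lt_of_ne (h.ne_of_cycle hde hef hdc hcb hdf hdb hec)
  have he := h.lt_of_ne (h.ne_of_cycle hef hfa hed hdc hea hec hfd)
  have hf := h.lt_of_ne (h.ne_of_cycle hfa hab hfe hed hfb hfd hae)
  have := not_isC6_labels ⟨_, ha⟩ ⟨_, hb⟩ (h.ok_true hab) ⟨_, hc⟩ (h.ok_true hbc)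
    (h.ok_false hac) ⟨_, hd⟩ (h.ok_true hcd) (h.ok_false hbd) (h.ok_false had) ⟨_, he⟩
    (h.ok_true hde) (h.ok_false hce) (h.ok_false hbe) (h.ok_false hae) ⟨_, hf⟩ (h.ok_true hef)
    (h.ok_true haf) (h.ok_false hbf) (h.ok_false hcf)
  rw [h.ok_false hdf] at this
  cases this

/-- An induced path on three vertices that contains a vertex with label `28` also contains a
vertex with another label that has a neighbor with label `28`. -/
theorem exists_of_path (h : SaucerLabeling G lab) {p q r : V} (hpq : rel G p q = true)
    (hqr : rel G q r = true) (hpr : rel G p r = false)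
    (h28 : lab p = 28 ∨ lab q = 28 ∨ lab r = 28) :
    ∃ k, (k = p ∨ k = q ∨ k = r) ∧ lab k ≠ 28 ∧ ∃ a, lab a = 28 ∧ rel G a k = true := by
  by_cases hq : lab q = 28
  · by_cases hp : lab p = 28
    · by_cases hr : lab r = 28
      · simp [h.rel_trans p q r hp hq hr hpq hqr] at hpr
      · exact ⟨r, by simp, hr, q, hq, hqr⟩
    · exact ⟨p, by simp, hp, q, hq, by rw [rel_comm, hpq]⟩
  · rcases h28 with hp | hq' | hr
    · exact ⟨q, by simp, hq, p, hp, hpq⟩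
    · exact absurd hq' hq
    · exact ⟨q, by simp, hq, r, hr, by rw [rel_comm, hqr]⟩

/-- If a vertex `k` with label other than `28` has a neighbor with label `28`, then the
non-neighbors of `k` do not contain an induced path on three vertices. -/
theorem rel_of_anticomplete (h : SaucerLabeling G lab) {k a s t w : V} (hk : lab k ≠ 28)
    (ha : lab a = 28) (hak : rel G a k = true) (hks : rel G k s = false)
    (hkt : rel G k t = false) (hkw : rel G k w = false) (hst : rel G s t = true)
    (htw : rel G t w = true) : rel G s w = true := by
  by_contra hsw
  rw [Bool.not_eq_true] at hsw
  have hfar : ∀ v, isFar (lab k) (lab v) = false := by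
    intro v
    by_contra hv
    rw [Bool.not_eq_false] at hv
    simp [h.rel_eq_false_of_isFar a k v ha hv] at hak
  have hk22 := h.lt_of_ne hk
  have hk7 := h.le_of_rel ha hak hk
  by_cases h28 : lab s = 28 ∨ lab t = 28 ∨ lab w = 28
  · obtain ⟨m, hm, hm28, b, hb, hbm⟩ := h.exists_of_path hst htw hsw h28
    have hkm : rel G k m = false := by
      rcases hm with rfl | rfl | rfl <;> assumption
    rcases isFar_of_ok ⟨_, hk22⟩ hk7 ⟨_, h.lt_of_ne hm28⟩ (h.le_of_rel hb hbm hm28)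
      (h.ok_false hkm) with hf | hf
    · simp [hfar m] at hf
    · simp [h.rel_eq_false_of_isFar b m k hb hf] at hbm
  · push Not at h28
    have := not_path_labels ⟨_, hk22⟩ hk7 ⟨_, h.lt_of_ne h28.1⟩ (h.ok_false hks) (hfar s)
      ⟨_, h.lt_of_ne h28.2.1⟩ (h.ok_false hkt) (hfar t) (h.ok_true hst)
      ⟨_, h.lt_of_ne h28.2.2⟩ (h.ok_false hkw) (hfar w) (h.ok_true htw)
    rw [h.ok_false hsw] at this
    cases this

theorem not_isTwoP3 (h : SaucerLabeling G lab) (a b c d e f : V) :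
    isTwoP3 (rel G) a b c d e f = false := by
  by_contra hC
  simp only [isTwoP3, Bool.not_eq_false, Bool.and_eq_true, Bool.not_eq_true', and_assoc] at hC
  obtain ⟨hab, hbc, hde, hef, hac, hdf, had, hae, haf, hbd, hbe, hbf, hcd, hce, hcf⟩ := hC
  have hc := rel_comm G
  by_cases h1 : lab a = 28 ∨ lab b = 28 ∨ lab c = 28
  · obtain ⟨k, hk, hk28, x, hx, hxk⟩ := h.exists_of_path hab hbc hac h1
    have := h.rel_of_anticomplete (s := d) (t := e) (w := f) hk28 hx hxk
    rcases hk with rfl | rfl | rfl <;> simp_all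
  by_cases h2 : lab d = 28 ∨ lab e = 28 ∨ lab f = 28
  · obtain ⟨k, hk, hk28, x, hx, hxk⟩ := h.exists_of_path hde hef hdf h2
    have := h.rel_of_anticomplete (s := a) (t := b) (w := c) hk28 hx hxk
    rcases hk with rfl | rfl | rfl <;> simp_all
  push Not at h1 h2
  have := not_isTwoP3_labels ⟨_, h.lt_of_ne h1.1⟩ ⟨_, h.lt_of_ne h1.2.1⟩ (h.ok_true hab)
    ⟨_, h.lt_of_ne h1.2.2⟩ (h.ok_true hbc) (h.ok_false hac)
    ⟨_, h.lt_of_ne h2.1⟩ (h.ok_false had) (h.ok_false hbd) (h.ok_false hcd)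
    ⟨_, h.lt_of_ne h2.2.1⟩ (h.ok_true hde) (h.ok_false hae) (h.ok_false hbe) (h.ok_false hce)
    ⟨_, h.lt_of_ne h2.2.2⟩ (h.ok_true hef) (h.ok_false hdf) (h.ok_false haf) (h.ok_false hbf)
  rw [h.ok_false hcf] at this
  cases this

theorem unobstructed (h : SaucerLabeling G lab) : Unobstructed G :=
  ⟨h.not_isC4, h.not_isC6, h.not_isTwoP3⟩

theorem complete (h : SaucerLabeling G lab) {l m : ℕ} (hlm : ok l m false = false)
    (hne : l ≠ m) : Complete G {v | lab v = l} {v | lab v = m} := by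
  rintro u rfl v rfl
  by_contra huv
  have huv' := h.ok_false (rel_eq_false (fun e => hne (congrArg lab e)) huv)
  rw [hlm] at huv'
  cases huv'

theorem anticomplete (h : SaucerLabeling G lab) {l m : ℕ} (hlm : ok l m true = false) :
    Anticomplete G {v | lab v = l} {v | lab v = m} := by
  rintro u rfl v rfl huv
  have huv' := h.ok_true (rel_of_adj huv)
  rw [hlm] at huv'
  cases huv'

theorem isClique (h : SaucerLabeling G lab) {l : ℕ} (hl : ok l l false = false) :
    G.IsClique {v | lab v = l} := by
  rintro u rfl v hv hne
  by_contra huv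
  have huv' := h.ok_false (rel_eq_false hne huv)
  rw [show lab v = lab u from hv, hl] at huv'
  cases huv'

theorem eq_empty (h : SaucerLabeling G lab) {l m : ℕ} (hlm : ∀ e, ok l m e = false)
    (hl : {v | lab v = l}.Nonempty) : {v | lab v = m} = ∅ := by
  obtain ⟨u, rfl⟩ := hl
  ext v
  simp only [Set.mem_ofPred_eq, Set.mem_empty_iff_false, iff_false]
  rintro rfl
  have := h.ok_rel u v
  rw [hlm] at this
  cases this

theorem orderedCliquesPartition [Finite V] (h : SaucerLabeling G lab) :
    OrderedCliquesPartition G {v | lab v = 28} := by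
  let A := {v | lab v = 28}
  let r : Setoid A := ⟨fun u v => rel G u v = true, fun u => rel_self G u,
    fun {u v} huv => by rw [rel_comm, huv],
    fun {u v w} huv hvw => h.rel_trans u v w u.2 v.2 w.2 huv hvw⟩
  obtain ⟨n, ⟨e⟩⟩ := Finite.exists_equiv_fin (Quotient r)
  have hrel : ∀ {u v : A}, (⟦u⟧ : Quotient r) = ⟦v⟧ ↔ rel G u v = true := Quotient.eq
  refine ⟨n, fun i => {v | ∃ hv : v ∈ A, e ⟦⟨v, hv⟩⟧ = i}, ?_, ?_, ?_, ?_, ?_, ?_⟩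
  · intro i
    obtain ⟨⟨v, hv⟩, hvi⟩ := Quotient.exists_rep (e.symm i)
    exact ⟨v, hv, by rw [hvi, e.apply_symm_apply]⟩
  · rintro i u ⟨hu, rfl⟩ v ⟨hv, huv⟩ hne
    exact adj_of_rel (hrel.1 (e.injective huv.symm)) hne
  · intro i j hij
    rw [Set.disjoint_left]
    rintro v ⟨hv, rfl⟩ ⟨_, rfl⟩
    exact hij rfl
  · rintro i j hij u ⟨hu, rfl⟩ v ⟨hv, rfl⟩ huv
    exact hij (congrArg e (hrel.2 (rel_of_adj huv)))
  · ext v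
    simp [A]
  · rintro i u ⟨hu, rfl⟩ v ⟨hv, huv⟩
    simp only [Set.subset_def, mem_closedNbhd_iff]
    exact h.chain u v hu hv (hrel.1 (e.injective huv.symm))

theorem isSevenSaucer [Finite V] (h : SaucerLabeling G lab) : IsSevenSaucer G := by
  have hdisj : ∀ l m, l ≠ m → Disjoint {v | lab v = l} {v | lab v = m} := by
    intro l m hlm
    rw [Set.disjoint_left]
    rintro v rfl hv
    exact hlm hv
  have hval : ∀ i j : ZMod 7, i ≠ j → i.val ≠ j.val := fun i j hij e =>
    hij (ZMod.val_injective 7 e)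
  have hlt : ∀ i : ZMod 7, i.val < 7 := ZMod.val_lt
  refine ⟨fun i => {v | lab v = i.val}, fun i => {v | lab v = 7 + i.val},
    fun i => {v | lab v = 14 + i.val}, {v | lab v = 21}, {v | lab v = 28},
    ⟨?_, ?_, ?_, ?_, ?_, ?_, ?_, ?_, ?_, ?_, ?_, ?_, ?_, ?_, ?_, ?_, ?_, ?_, ?_, ?_, ?_⟩,
    ?_, ?_, Or.inr h.orderedCliquesPartition⟩
  · exact fun i j hij => hdisj _ _ (hval i j hij)
  · exact fun i j hij => hdisj _ _ (by have := hval i j hij; omega)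
  · exact fun i j hij => hdisj _ _ (by have := hval i j hij; omega)
  · exact fun i j => hdisj _ _ (by have := hlt i; omega)
  · exact fun i j => hdisj _ _ (by have := hlt i; omega)
  · exact fun i j => hdisj _ _ (by have := hlt i; omega)
  · exact fun i => hdisj _ _ (by have := hlt i; omega)
  · exact fun i => hdisj _ _ (by have := hlt i; omega)
  · exact fun i => hdisj _ _ (by have := hlt i; omega)
  · have hlab : ∀ l ∈ labels, ((((∃ i : ZMod 7, l = i.val) ∨ ∃ i : ZMod 7, l = 7 + i.val) ∨
        ∃ i : ZMod 7, l = 14 + i.val) ∨ l = 21) ↔ ¬ l = 28 := by decide +kernel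
    ext v
    simpa using hlab _ (h.mem_labels v)
  · exact fun i => h.isClique (by clear * - i; revert i; decide +kernel)
  · exact fun i => h.isClique (by clear * - i; revert i; decide +kernel)
  · exact fun i => h.isClique (by clear * - i; revert i; decide +kernel)
  · exact h.isClique (by decide +kernel)
  · exact fun i => h.exists_eq _ (hlt i)
  · intro i
    refine ⟨?_, ?_, ?_, ?_, ?_, ?_⟩ <;> first
      | exact h.complete (by clear * - i; revert i; decide +kernel)
            (by clear * - i; revert i; decide +kernel)
      | exact h.anticomplete (by clear * - i; revert i; decide +kernel)
  · intro i
    refine ⟨?_, ?_, ?_, ?_, ?_, ?_, ?_, ?_, ?_, ?_, ?_, ?_, ?_, ?_, ?_⟩ <;> first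
      | exact h.complete (by clear * - i; revert i; decide +kernel)
            (by clear * - i; revert i; decide +kernel)
      | exact h.anticomplete (by clear * - i; revert i; decide +kernel)
  · refine fun i hi => ⟨⟨?_, ?_, ?_, ?_, ?_, ?_⟩, ?_⟩
    iterate 6 exact h.eq_empty (by clear * - i; revert i; decide +kernel) hi
    rw [or_iff_not_imp_left, ← ne_eq, ← Set.nonempty_iff_ne_empty]
    exact h.eq_empty (by clear * - i; revert i; decide +kernel)
  · refine fun i hi => ⟨?_, ?_⟩ <;> exact h.eq_empty (by clear * - i; revert i; decide +kernel) hi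
  · intro i
    refine ⟨?_, ?_, ?_, ?_, ?_, ?_, ?_, ?_⟩ <;> first
      | exact h.complete (by clear * - i; revert i; decide +kernel)
            (by clear * - i; revert i; decide +kernel)
      | exact h.anticomplete (by clear * - i; revert i; decide +kernel)
  · intro i
    refine ⟨?_, ?_, ?_, ?_, ?_⟩ <;>
      exact h.complete (by clear * - i; revert i; decide +kernel)
          (by clear * - i; revert i; decide +kernel)
  · exact fun i => h.anticomplete (by clear * - i; revert i; decide +kernel)
  · intro i
    rw [or_iff_not_imp_right, ← ne_eq, ← Set.nonempty_iff_ne_empty]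
    rintro ⟨z, hz⟩ a ha y hy hay
    have hf : isFar (lab y) (lab z) = true := by
      rw [show lab y = _ from hy, show lab z = _ from hz]
      clear * - i
      revert i
      decide +kernel
    simpa [h.rel_eq_false_of_isFar a y z ha hf] using rel_of_adj hay

end SaucerLabeling

section Backward

variable {G : SimpleGraph V} {S T : Set V} {u v : V} {l m : ℕ}

theorem ok_rel_of_complete (hST : Complete G S T) (hu : u ∈ S) (hv : v ∈ T)
    (hok : ok l m true = true) : ok l m (rel G u v) = true := by
  rwa [rel_of_adj (hST u hu v hv)]

theorem ok_rel_of_anticomplete (hST : Anticomplete G S T) (hdisj : Disjoint S T) (hu : u ∈ S)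
    (hv : v ∈ T) (hok : ok l m false = true) : ok l m (rel G u v) = true := by
  rwa [rel_eq_false (hdisj.ne_of_mem hu hv) (hST u hu v hv)]

theorem ok_rel_of_isClique (hS : G.IsClique S) (hu : u ∈ S) (hv : v ∈ S)
    (hok : ok l m true = true) : ok l m (rel G u v) = true := by
  by_cases huv : u = v
  · rwa [huv, rel_self]
  · rwa [rel_of_adj (hS hu hv huv)]

theorem ok_comm : ∀ l ∈ labels, ∀ m ∈ labels, ∀ e, ok l m e = ok m l e := by
  decide +kernel

/-- `l` is the label of a class of the given partition that contains `v`. -/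
def HasLabel (X Y Z : ZMod 7 → Set V) (W A : Set V) (v : V) (l : ℕ) : Prop :=
  (∃ i, v ∈ X i ∧ l = i.val) ∨ (∃ i, v ∈ Y i ∧ l = 7 + i.val) ∨
    (∃ i, v ∈ Z i ∧ l = 14 + i.val) ∨ (v ∈ W ∧ l = 21) ∨ (v ∈ A ∧ l = 28)

theorem exists_eq_add (i j : ZMod 7) : ∃ d, j = i + d ∧
    (d = 0 ∨ d = 1 ∨ d = 2 ∨ d = 3 ∨ d = 4 ∨ d = 5 ∨ d = 6) :=
  ⟨j - i, by ring, by generalize j - i = d; revert d; decide⟩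

theorem IsSevenSaucer.exists_saucerLabeling (h : IsSevenSaucer G) :
    ∃ lab, SaucerLabeling G lab := by
  obtain ⟨X, Y, Z, W, A, ⟨dXX, dYY, dZZ, dXY, dXZ, dYZ, dXW, dYW, dZW, hcover, cX, cY, cZ, cW, hX,
    hb, hc, hd, he, hf, hg⟩, hAX, hAY, hA⟩ := h
  have hmem : ∀ v, (((∃ i, v ∈ X i) ∨ ∃ i, v ∈ Y i) ∨ ∃ i, v ∈ Z i) ∨ v ∈ W ↔ v ∉ A := by
    intro v
    simpa using Set.ext_iff.1 hcover v
  have dX : ∀ i, Disjoint A (X i) := fun i => Set.disjoint_right.2 fun v hv =>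
    (hmem v).1 (.inl (.inl (.inl ⟨i, hv⟩)))
  have dY : ∀ i, Disjoint A (Y i) := fun i => Set.disjoint_right.2 fun v hv =>
    (hmem v).1 (.inl (.inl (.inr ⟨i, hv⟩)))
  have dZ : ∀ i, Disjoint A (Z i) := fun i => Set.disjoint_right.2 fun v hv =>
    (hmem v).1 (.inl (.inr ⟨i, hv⟩))
  have dW : Disjoint A W := Set.disjoint_right.2 fun v hv => (hmem v).1 (.inr hv)
  have hlab : ∀ v, ∃ l, HasLabel X Y Z W A v l := by
    intro v
    by_cases hv : v ∈ A
    · exact ⟨28, by simp [HasLabel, hv]⟩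
    · rcases (hmem v).2 hv with ((⟨i, hi⟩ | ⟨i, hi⟩) | ⟨i, hi⟩) | hi
      · exact ⟨_, .inl ⟨i, hi, rfl⟩⟩
      · exact ⟨_, .inr (.inl ⟨i, hi, rfl⟩)⟩
      · exact ⟨_, .inr (.inr (.inl ⟨i, hi, rfl⟩))⟩
      · exact ⟨_, .inr (.inr (.inr (.inl ⟨hi, rfl⟩)))⟩
  choose lab hlab using hlab
  have hlt : ∀ i : ZMod 7, i.val < 7 := ZMod.val_lt
  have labX : ∀ v i, v ∈ X i → lab v = i.val := by
    intro v i hv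
    rcases hlab v with ⟨j, hj, e⟩ | ⟨j, hj, e⟩ | ⟨j, hj, e⟩ | ⟨hj, e⟩ | ⟨hj, e⟩
    · by_cases hij : i = j
      · rw [hij, e]
      · exact absurd hj (Set.disjoint_left.1 (dXX i j hij) hv)
    · exact absurd hj (Set.disjoint_left.1 (dXY i j) hv)
    · exact absurd hj (Set.disjoint_left.1 (dXZ i j) hv)
    · exact absurd hj (Set.disjoint_left.1 (dXW i) hv)
    · exact absurd hj (Set.disjoint_right.1 (dX i) hv)
  have memA : ∀ v, lab v = 28 → v ∈ A := by
    intro v hv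
    rcases hlab v with ⟨j, hj, e⟩ | ⟨j, hj, e⟩ | ⟨j, hj, e⟩ | ⟨hj, e⟩ | ⟨hj, e⟩
    iterate 3 have := hlt j; omega
    · omega
    · exact hj
  have hlabels : ∀ v, lab v ∈ labels := by
    intro v
    simp only [labels, List.mem_append, List.mem_range, List.mem_singleton]
    rcases hlab v with ⟨j, hj, e⟩ | ⟨j, hj, e⟩ | ⟨j, hj, e⟩ | ⟨hj, e⟩ | ⟨hj, e⟩
    iterate 3 have := hlt j; omega
    iterate 2 omega
  have sub_one : ∀ i : ZMod 7, i - 1 = i + 6 := by decide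
  have hXX : ∀ i j u v, u ∈ X i → v ∈ X j → ok i.val j.val (rel G u v) = true := by
    intro i j u v hu hv
    obtain ⟨b6, b1, b2, b3, b4, b5⟩ := hb i
    rw [sub_one] at b6
    have hdisj : ∀ d ≠ 0, Disjoint (X i) (X (i + d)) :=
      fun d hd => dXX _ _ (by simpa [eq_comm] using hd)
    obtain ⟨d, rfl, rfl | rfl | rfl | rfl | rfl | rfl | rfl⟩ := exists_eq_add i j
    · rw [add_zero] at hv ⊢
      exact ok_rel_of_isClique (cX i) hu hv (by clear * - i; revert i; decide +kernel)
    · exact ok_rel_of_complete b1 hu hv (by clear * - i; revert i; decide +kernel)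
    · exact ok_rel_of_anticomplete b2 (hdisj 2 (by decide)) hu hv
          (by clear * - i; revert i; decide +kernel)
    · exact ok_rel_of_anticomplete b3 (hdisj 3 (by decide)) hu hv
          (by clear * - i; revert i; decide +kernel)
    · exact ok_rel_of_anticomplete b4 (hdisj 4 (by decide)) hu hv
          (by clear * - i; revert i; decide +kernel)
    · exact ok_rel_of_anticomplete b5 (hdisj 5 (by decide)) hu hv
          (by clear * - i; revert i; decide +kernel)
    · exact ok_rel_of_complete b6 hu hv (by clear * - i; revert i; decide +kernel)
  have hXY : ∀ i j u v, u ∈ X i → v ∈ Y j → ok i.val (7 + j.val) (rel G u v) = true := by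
    intro i j u v hu hv
    obtain ⟨c0, c3, c6, -, -, -, -, -, -, c1, c2, c4, c5, -, -⟩ := hc i
    obtain ⟨d, rfl, rfl | rfl | rfl | rfl | rfl | rfl | rfl⟩ := exists_eq_add i j
    · rw [add_zero] at hv ⊢
      exact ok_rel_of_complete c0 hu hv (by clear * - i; revert i; decide +kernel)
    · exact ok_rel_of_anticomplete c1 (dXY _ _) hu hv (by clear * - i; revert i; decide +kernel)
    · exact ok_rel_of_anticomplete c2 (dXY _ _) hu hv (by clear * - i; revert i; decide +kernel)
    · exact ok_rel_of_complete c3 hu hv (by clear * - i; revert i; decide +kernel)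
    · exact ok_rel_of_anticomplete c4 (dXY _ _) hu hv (by clear * - i; revert i; decide +kernel)
    · exact ok_rel_of_anticomplete c5 (dXY _ _) hu hv (by clear * - i; revert i; decide +kernel)
    · exact ok_rel_of_complete c6 hu hv (by clear * - i; revert i; decide +kernel)
  have hXZ : ∀ i j u v, u ∈ X i → v ∈ Z j → ok i.val (14 + j.val) (rel G u v) = true := by
    intro i j u v hu hv
    obtain ⟨-, -, -, c0, c3, c4, c5, c6, -, -, -, -, -, c1, c2⟩ := hc i
    obtain ⟨d, rfl, rfl | rfl | rfl | rfl | rfl | rfl | rfl⟩ := exists_eq_add i j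
    · rw [add_zero] at hv ⊢
      exact ok_rel_of_complete c0 hu hv (by clear * - i; revert i; decide +kernel)
    · exact ok_rel_of_anticomplete c1 (dXZ _ _) hu hv (by clear * - i; revert i; decide +kernel)
    · exact ok_rel_of_anticomplete c2 (dXZ _ _) hu hv (by clear * - i; revert i; decide +kernel)
    · exact ok_rel_of_complete c3 hu hv (by clear * - i; revert i; decide +kernel)
    · exact ok_rel_of_complete c4 hu hv (by clear * - i; revert i; decide +kernel)
    · exact ok_rel_of_complete c5 hu hv (by clear * - i; revert i; decide +kernel)
    · exact ok_rel_of_complete c6 hu hv (by clear * - i; revert i; decide +kernel)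
  have hYY : ∀ i j u v, u ∈ Y i → v ∈ Y j → ok (7 + i.val) (7 + j.val) (rel G u v) = true := by
    intro i j u v hu hv
    obtain ⟨⟨e1, e2, e5, e6, -, -⟩, -⟩ := hd i ⟨u, hu⟩
    obtain ⟨f3, f4, -⟩ := hf i
    obtain ⟨d, rfl, rfl | rfl | rfl | rfl | rfl | rfl | rfl⟩ := exists_eq_add i j
    · rw [add_zero] at hv ⊢
      exact ok_rel_of_isClique (cY i) hu hv (by clear * - i; revert i; decide +kernel)
    · simp [e1] at hv
    · simp [e2] at hv
    · exact ok_rel_of_complete f3 hu hv (by clear * - i; revert i; decide +kernel)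
    · exact ok_rel_of_complete f4 hu hv (by clear * - i; revert i; decide +kernel)
    · simp [e5] at hv
    · simp [e6] at hv
  have hYZ : ∀ i j u v, u ∈ Y i → v ∈ Z j → ok (7 + i.val) (14 + j.val) (rel G u v) = true := by
    intro i j u v hu hv
    obtain ⟨⟨-, -, -, -, e5, e6⟩, -⟩ := hd i ⟨u, hu⟩
    obtain ⟨-, -, f0, f1, f3, f4, -, f2⟩ := hf i
    obtain ⟨d, rfl, rfl | rfl | rfl | rfl | rfl | rfl | rfl⟩ := exists_eq_add i j
    · rw [add_zero] at hv ⊢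
      exact ok_rel_of_complete f0 hu hv (by clear * - i; revert i; decide +kernel)
    · exact ok_rel_of_complete f1 hu hv (by clear * - i; revert i; decide +kernel)
    · exact ok_rel_of_anticomplete f2 (dYZ _ _) hu hv (by clear * - i; revert i; decide +kernel)
    · exact ok_rel_of_complete f3 hu hv (by clear * - i; revert i; decide +kernel)
    · exact ok_rel_of_complete f4 hu hv (by clear * - i; revert i; decide +kernel)
    · simp [e5] at hv
    · simp [e6] at hv
  have hZZ : ∀ i j u v, u ∈ Z i → v ∈ Z j → ok (14 + i.val) (14 + j.val) (rel G u v) = true := by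
    intro i j u v hu hv
    obtain ⟨e2, e5⟩ := he i ⟨u, hu⟩
    obtain ⟨g1, g3, g4, g6, -⟩ := hg i
    obtain ⟨d, rfl, rfl | rfl | rfl | rfl | rfl | rfl | rfl⟩ := exists_eq_add i j
    · rw [add_zero] at hv ⊢
      exact ok_rel_of_isClique (cZ i) hu hv (by clear * - i; revert i; decide +kernel)
    · exact ok_rel_of_complete g1 hu hv (by clear * - i; revert i; decide +kernel)
    · simp [e2] at hv
    · exact ok_rel_of_complete g3 hu hv (by clear * - i; revert i; decide +kernel)
    · exact ok_rel_of_complete g4 hu hv (by clear * - i; revert i; decide +kernel)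
    · simp [e5] at hv
    · exact ok_rel_of_complete g6 hu hv (by clear * - i; revert i; decide +kernel)
  have hW : ∀ u v, v ∈ W → ok (lab u) 21 (rel G u v) = true := by
    intro u v hv
    rcases hlab u with ⟨i, hi, e⟩ | ⟨i, hi, e⟩ | ⟨i, hi, e⟩ | ⟨hi, e⟩ | ⟨hi, e⟩ <;> rw [e]
    · obtain ⟨-, -, -, -, -, -, -, -, c, -⟩ := hc i
      exact ok_rel_of_complete c hi hv (by clear * - i; revert i; decide +kernel)
    · obtain ⟨-, -, -, -, -, -, f, -⟩ := hf i
      exact ok_rel_of_complete f hi hv (by clear * - i; revert i; decide +kernel)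
    · obtain ⟨-, -, -, -, g⟩ := hg i
      exact ok_rel_of_complete g hi hv (by clear * - i; revert i; decide +kernel)
    · exact ok_rel_of_isClique cW hi hv (by decide +kernel)
    · generalize rel G u v = e
      revert e
      decide +kernel
  have hA28 : ∀ u v, v ∈ A → ok (lab u) 28 (rel G u v) = true := by
    intro u v hv
    rcases hlab u with ⟨i, hi, e⟩ | hu
    · rw [e, rel_comm]
      exact ok_rel_of_anticomplete (hAX i) (dX i) hv hi (by clear * - i; revert i; decide +kernel)
    · have h7 : 7 ≤ lab u := by
        rcases hu with ⟨j, hj, e⟩ | ⟨j, hj, e⟩ | ⟨hj, e⟩ | ⟨hj, e⟩ <;> omega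
      have key : ∀ l ∈ labels, 7 ≤ l → ∀ e, ok l 28 e = true := by decide +kernel
      exact key _ (hlabels u) h7 _
  have hsymm : ∀ u v, ok (lab v) (lab u) (rel G v u) = true →
      ok (lab u) (lab v) (rel G u v) = true := by
    intro u v huv
    rwa [ok_comm _ (hlabels u) _ (hlabels v), rel_comm]
  have hpart : ∀ a b, lab a = 28 → lab b = 28 → rel G a b = true →
      ∃ S, a ∈ S ∧ b ∈ S ∧ G.IsClique S ∧ ChainClosedNbhd G S ∧
        ∀ c, lab c = 28 → rel G b c = true → c ∈ S := by
    rcases hA with hA | ⟨n, P, -, hcl, -, hanti, hU, hchain⟩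
    · intro a b ha
      simpa [hA] using memA a ha
    · have hP : ∀ v, lab v = 28 → ∃ i, v ∈ P i := fun v hv => by
        simpa [← hU] using memA v hv
      have hmemP : ∀ u v i, u ∈ P i → lab v = 28 → rel G u v = true → v ∈ P i := by
        intro u v i hu hv huv
        obtain ⟨j, hj⟩ := hP v hv
        by_cases hij : i = j
        · rwa [hij]
        · by_cases huv' : u = v
          · rwa [← huv']
          · exact absurd (adj_of_rel huv huv') (hanti i j hij u hu v hj)
      intro a b ha hb hab
      obtain ⟨i, hi⟩ := hP a ha
      have hbi := hmemP a b i hi hb hab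
      exact ⟨P i, hi, hbi, hcl i, hchain i, fun c hc hbc => hmemP b c i hbi hc hbc⟩
  refine ⟨lab, hlabels, ?_, ?_, ?_, ?_, ?_⟩
  · intro i hi
    obtain ⟨v, hv⟩ := hX i
    exact ⟨v, by rw [labX v _ hv, ZMod.val_natCast, Nat.mod_eq_of_lt hi]⟩
  · intro u v
    rcases hlab u with ⟨i, hi, e⟩ | ⟨i, hi, e⟩ | ⟨i, hi, e⟩ | ⟨hi, e⟩ | ⟨hi, e⟩ <;>
    rcases hlab v with ⟨j, hj, e'⟩ | ⟨j, hj, e'⟩ | ⟨j, hj, e'⟩ | ⟨hj, e'⟩ | ⟨hj, e'⟩ <;>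
    first
      | (rw [e, e']; first
          | exact hXX i j u v hi hj
          | exact hXY i j u v hi hj
          | exact hXZ i j u v hi hj
          | exact hYY i j u v hi hj
          | exact hYZ i j u v hi hj
          | exact hZZ i j u v hi hj)
      | (rw [e']; first | exact hW u v hj | exact hA28 u v hj)
      | (apply hsymm; rw [e, e']; first
          | exact hXY j i v u hj hi
          | exact hXZ j i v u hj hi
          | exact hYZ j i v u hj hi)
      | (apply hsymm; rw [e]; first | exact hW v u hi | exact hA28 v u hi)
  · intro a y z ha hyz
    have haA := memA a ha
    simp only [isFar, Bool.and_eq_true, decide_eq_true_eq] at hyz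
    obtain ⟨hy, hz⟩ := hyz
    rcases hlab y with ⟨i, hi, e⟩ | ⟨i, hi, e⟩ | ⟨i, hi, e⟩ | ⟨hi, e⟩ | ⟨hi, e⟩
    · have := hlt i; omega
    · rcases hlab z with ⟨j, hj, e'⟩ | ⟨j, hj, e'⟩ | ⟨j, hj, e'⟩ | ⟨hj, e'⟩ | ⟨hj, e'⟩
      · have := hlt j; omega
      · have := hlt j; omega
      · have hj' : j = i + 2 := by
          rw [e, e'] at hz
          clear * - hz
          revert i j
          decide +kernel
        rcases hAY i with h' | h'
        · exact rel_eq_false ((dY i).ne_of_mem haA hi) (h' a haA y hi)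
        · simp [hj', h'] at hj
      · omega
      · omega
    · have := hlt i; omega
    · omega
    · omega
  · intro a b c ha hb hc hab hbc
    obtain ⟨S, haS, -, hS, -, hmemS⟩ := hpart a b ha hb hab
    by_cases hac : a = c
    · rw [hac, rel_self]
    · exact rel_of_adj (hS haS (hmemS c hc hbc) hac)
  · intro a b ha hb hab
    obtain ⟨S, haS, hbS, -, hS, -⟩ := hpart a b ha hb hab
    simpa only [Set.subset_def, mem_closedNbhd_iff] using hS a haS b hbS

end Backward

/-- A graph is `(2P_3,C_4,C_6)`-free and contains an induced `C_7` if and only if it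
is a 7-saucer. -/
theorem statement4 {V : Type*} [Fintype V] (G : SimpleGraph V) :
    (HFree G twoP3 ∧ HFree G (cycleGraph 4) ∧ HFree G (cycleGraph 6) ∧
      ContainsInduced G (cycleGraph 7)) ↔ IsSevenSaucer G := by
  constructor
  · rintro ⟨h2, h4, h6, h7⟩
    obtain ⟨x, hx⟩ := (containsInduced_c7_iff G).1 h7
    obtain ⟨lab, h⟩ := ((unobstructed_iff G).2 ⟨h2, h4, h6⟩).exists_saucerLabeling hx
    exact h.isSevenSaucer
  · intro hG
    obtain ⟨lab, h⟩ := hG.exists_saucerLabeling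
    obtain ⟨h2, h4, h6⟩ := (unobstructed_iff G).1 h.unobstructed
    exact ⟨h2, h4, h6, h.containsInduced_c7⟩

end Paper2P3
end

section
/- A graph G admits a special partition if and only if G can be obtained from a thickening of a graph in the family ℳ by possibly adding universal vertices to it. -/
open SimpleGraph

namespace Paper2P3

variable {V : Type*}

section Complete

variable {G : SimpleGraph V} {A B C : Set V}

theorem Complete.symm (h : Complete G A B) : Complete G B A :=
  fun b hb a ha => (h a ha b hb).symm

theorem Anticomplete.symm (h : Anticomplete G A B) : Anticomplete G B A :=
  fun b hb a ha hab => h a ha b hb hab.symm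

theorem complete_of_eq_empty_left (h : A = ∅) : Complete G A B := by
  simp [Complete, h]

theorem complete_of_eq_empty_right (h : B = ∅) : Complete G A B := by
  simp [Complete, h]

end Complete

section Blowup

variable {α β : Type*}

/-- The sets `P a` partition `S` into cliques that are joined to each other as in `H`;
unlike in a thickening, they may be empty. -/
structure IsBlowup (G : SimpleGraph V) (H : SimpleGraph α) (P : α → Set V) (S : Set V) :
    Prop where
  disjoint : ∀ a b, a ≠ b → Disjoint (P a) (P b)
  iUnion_eq : ⋃ a, P a = S
  isClique : ∀ a, G.IsClique (P a)
  complete : ∀ a b, H.Adj a b → Complete G (P a) (P b)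
  anticomplete : ∀ a b, a ≠ b → ¬ H.Adj a b → Anticomplete G (P a) (P b)

theorem IsBlowup.isThickening_induce {G : SimpleGraph V} {H : SimpleGraph α} {P : α → Set V}
    {S : Set V} (h : IsBlowup G H P S) :
    IsThickening (G.induce S) (H.induce {a | (P a).Nonempty}) := by
  have hS : ∀ a, P a ⊆ S := fun a => h.iUnion_eq ▸ Set.subset_iUnion P a
  refine ⟨fun a => {v | v.1 ∈ P a.1}, ?_, ?_, ?_, ?_, ?_⟩
  · rintro ⟨a, v, hv⟩
    exact ⟨⟨v, hS a hv⟩, hv⟩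
  · intro a b hab
    refine Set.disjoint_left.2 fun v hva hvb => ?_
    exact Set.disjoint_left.1 (h.disjoint a b (Subtype.coe_ne_coe.2 hab)) hva hvb
  · refine Set.eq_univ_of_forall fun v => ?_
    obtain ⟨a, ha⟩ := Set.mem_iUnion.1 (h.iUnion_eq.symm ▸ v.2 : v.1 ∈ ⋃ a, P a)
    exact Set.mem_iUnion.2 ⟨⟨a, v, ha⟩, ha⟩
  · intro a u hu v hv huv
    exact h.isClique a hu hv (Subtype.coe_ne_coe.2 huv)
  · intro a b hab
    exact ⟨fun hadj u hu v hv => h.complete a b hadj u hu v hv,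
      fun hadj u hu v hv => h.anticomplete a b (Subtype.coe_ne_coe.2 hab) hadj u hu v hv⟩

theorem IsThickening.exists_isBlowup {G : SimpleGraph V} {H : SimpleGraph α} {S : Set V}
    {T : Set α} (h : IsThickening (G.induce S) (H.induce T)) :
    ∃ P : α → Set V, IsBlowup G H P S ∧ {a | (P a).Nonempty} = T := by
  obtain ⟨X, hne, hdisj, hU, hcl, hadj⟩ := h
  refine ⟨fun a => {v | ∃ (ha : a ∈ T) (hv : v ∈ S), ⟨v, hv⟩ ∈ X ⟨a, ha⟩},
    ⟨?_, ?_, ?_, ?_, ?_⟩, ?_⟩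
  · intro a b hab
    refine Set.disjoint_left.2 ?_
    rintro v ⟨ha, hv, hva⟩ ⟨hb, hv', hvb⟩
    exact Set.disjoint_left.1 (hdisj ⟨a, ha⟩ ⟨b, hb⟩ (by simpa using hab)) hva hvb
  · ext v
    simp only [Set.mem_iUnion, Set.mem_ofPred_eq]
    refine ⟨fun ⟨_, _, hv, _⟩ => hv, fun hv => ?_⟩
    obtain ⟨a, ha⟩ := Set.mem_iUnion.1 (hU.symm ▸ Set.mem_univ (⟨v, hv⟩ : S))
    exact ⟨a, a.2, hv, ha⟩
  · rintro a u ⟨ha, hu, hua⟩ v ⟨ha', hv, hva⟩ huv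
    exact hcl ⟨a, ha⟩ hua hva fun h => huv (congrArg Subtype.val h)
  · rintro a b hab u ⟨ha, hu, hua⟩ v ⟨hb, hv, hvb⟩
    exact (hadj ⟨a, ha⟩ ⟨b, hb⟩ (by simpa using hab.ne)).1 hab _ hua _ hvb
  · rintro a b hne hab u ⟨ha, hu, hua⟩ v ⟨hb, hv, hvb⟩
    exact (hadj ⟨a, ha⟩ ⟨b, hb⟩ (by simpa using hne)).2 hab _ hua _ hvb
  · ext a
    refine ⟨fun ⟨_, ha, _⟩ => ha, fun ha => ?_⟩
    obtain ⟨v, hv⟩ := hne ⟨a, ha⟩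
    exact ⟨v, ha, v.2, hv⟩

theorem IsThickening.of_iso {K : SimpleGraph V} {M : SimpleGraph α} {H : SimpleGraph β}
    (e : M ≃g H) (h : IsThickening K M) : IsThickening K H := by
  obtain ⟨X, hne, hdisj, hU, hcl, hadj⟩ := h
  refine ⟨X ∘ e.symm, fun b => hne _, fun a b hab => hdisj _ _ (e.symm.injective.ne hab), ?_,
    fun b => hcl _, fun a b hab => ?_⟩
  · rw [← hU]
    exact e.symm.surjective.iUnion_comp X
  · rw [← e.symm.map_adj_iff]
    exact hadj _ _ (e.symm.injective.ne hab)

/-- An embedding identifies the subgraph induced on a set with the one induced on its image. -/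
noncomputable def induceImageIso {M : SimpleGraph α} {H : SimpleGraph β} (f : M ↪g H)
    (U : Set α) : M.induce U ≃g H.induce (f '' U) where
  toEquiv := Equiv.Set.image f U f.injective
  map_rel_iff' := f.map_adj_iff

/-- An embedding identifies its source with the subgraph induced on its range. -/
noncomputable def induceRangeIso {M : SimpleGraph α} {H : SimpleGraph β} (f : M ↪g H) :
    M ≃g H.induce (Set.range f) where
  toEquiv := Equiv.ofInjective f f.injective
  map_rel_iff' := f.map_adj_iff

end Blowup

/-- Labels for the parts `X_i`, `Y_i`, `Z_i` of a special partition. -/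
inductive PartLabel
  | x (i : ZMod 7)
  | y (i : ZMod 7)
  | z (i : ZMod 7)
  deriving DecidableEq, Fintype

namespace PartLabel

/-- The adjacency between parts prescribed by a special partition. Pairs that cannot both be
nonempty are declared adjacent. -/
def Joined : PartLabel → PartLabel → Prop
  | x i, x j => j - i = 1 ∨ i - j = 1
  | x i, y j | y j, x i => i - j = 0 ∨ i - j = 1 ∨ i - j = 4
  | x i, z j | z j, x i => i - j ≠ 5 ∧ i - j ≠ 6
  | y i, y j => i ≠ j
  | y i, z j | z j, y i => j - i ≠ 2
  | z i, z j => i ≠ j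

instance : DecidableRel Joined := fun a b => by
  cases a <;> cases b <;> unfold Joined <;> infer_instance

/-- The pattern graph of special partitions. -/
def pattern : SimpleGraph PartLabel where
  Adj := Joined
  symm := ⟨by decide⟩
  loopless := ⟨by decide⟩

instance : DecidableRel pattern.Adj := inferInstanceAs (DecidableRel Joined)

/-- Two parts are compatible if a special partition allows both of them to be nonempty. -/
def Compatible : PartLabel → PartLabel → Prop
  | y i, y j => j - i = 0 ∨ j - i = 3 ∨ j - i = 4
  | y i, z j | z j, y i => j - i ≠ 5 ∧ j - i ≠ 6
  | z i, z j => j - i ≠ 2 ∧ j - i ≠ 5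
  | _, _ => True

instance : DecidableRel Compatible := fun a b => by
  cases a <;> cases b <;> unfold Compatible <;> infer_instance

/-- The sets of parts that can be the nonempty parts of a special partition. -/
structure IsAdmissible (T : Set PartLabel) : Prop where
  x_mem : ∀ i, x i ∈ T
  compatible : ∀ a ∈ T, ∀ b ∈ T, Compatible a b

/-- Rotation of the labels. -/
def shift (k : ZMod 7) : PartLabel → PartLabel
  | x i => x (k + i)
  | y i => y (k + i)
  | z i => z (k + i)

/-- Rotation as an automorphism of the pattern graph. -/
def rotation (k : ZMod 7) : pattern ≃g pattern where
  toFun := shift k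
  invFun := shift (-k)
  left_inv := by rintro (i | i | i) <;> simp [shift]
  right_inv := by rintro (i | i | i) <;> simp [shift]
  map_rel_iff' := by rintro (i | i | i) (j | j | j) <;> simp [shift, pattern, Joined]

theorem IsAdmissible.rotate {T : Set PartLabel} (h : IsAdmissible T) (k : ZMod 7) :
    IsAdmissible (rotation k ⁻¹' T) where
  x_mem i := h.x_mem (k + i)
  compatible a ha b hb := by
    have := h.compatible _ ha _ hb
    revert this
    rcases a with i | i | i <;> rcases b with j | j | j <;> simp [rotation, shift, Compatible]

theorem isThickening_rotate {K : SimpleGraph V} {T : Set PartLabel}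
    (h : IsThickening K (pattern.induce T)) (k : ZMod 7) :
    IsThickening K (pattern.induce (rotation k ⁻¹' T)) := by
  have e := induceImageIso (rotation k).toEmbedding (rotation k ⁻¹' T)
  rw [RelIso.coe_toRelEmbedding, Set.image_preimage_eq _ (rotation k).surjective] at e
  exact h.of_iso e.symm

/-- The standard copy of `M_0` in the pattern graph. -/
def embedM0 : M0 ↪g pattern where
  toFun := ![x 0, x 1, x 2, x 3, x 4, x 5, x 6, y 0, y 3, z 0, z 3, z 4]
  inj' := by decide
  map_rel_iff' := by unfold M0; decide

/-- The mirror image of the standard copy of `M_0`, reflected so that `Y_0` is fixed. -/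
def embedM0Reflected : M0 ↪g pattern where
  toFun := ![x 1, x 0, x 6, x 5, x 4, x 3, x 2, y 0, y 4, z 4, z 1, z 0]
  inj' := by decide
  map_rel_iff' := by unfold M0; decide

/-- The standard copy of `M_1` in the pattern graph. -/
def embedM1 : M1 ↪g pattern where
  toFun := ![x 0, x 1, x 2, x 3, x 4, x 5, x 6, y 0, z 2]
  inj' := by decide
  map_rel_iff' := by unfold M1; decide

/-- The standard copy of `M_2` in the pattern graph. -/
def embedM2 : M2 ↪g pattern where
  toFun := ![x 0, x 1, x 2, x 3, x 4, x 5, x 6, y 0, z 2, z 1]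
  inj' := by decide
  map_rel_iff' := by unfold M2; decide

/-- The standard copy of `M_3` in the pattern graph. -/
def embedM3 : M3 ↪g pattern where
  toFun := ![x 0, x 1, x 2, x 3, x 4, x 5, x 6, y 0, z 2, z 3]
  inj' := by decide
  map_rel_iff' := by unfold M3; decide

theorem isAdmissible_range {α : Type*} {f : α → PartLabel} (hx : ∀ i, ∃ a, f a = x i)
    (hf : ∀ a b, Compatible (f a) (f b)) : IsAdmissible (Set.range f) where
  x_mem := hx
  compatible := by
    rintro _ ⟨a, rfl⟩ _ ⟨b, rfl⟩
    exact hf a b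

theorem exists_isAdmissible_of_isThickeningOfM {K : SimpleGraph V} (h : IsThickeningOfM K) :
    ∃ T, IsAdmissible T ∧ IsThickening K (pattern.induce T) := by
  rcases h with h | h | h | ⟨S, hS, h⟩
  · exact ⟨_, isAdmissible_range (by decide) (by decide), h.of_iso (induceRangeIso embedM1)⟩
  · exact ⟨_, isAdmissible_range (by decide) (by decide), h.of_iso (induceRangeIso embedM2)⟩
  · exact ⟨_, isAdmissible_range (by decide) (by decide), h.of_iso (induceRangeIso embedM3)⟩
  · refine ⟨_, ⟨fun i => ?_, ?_⟩, h.of_iso (induceImageIso embedM0 Sᶜ)⟩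
    · have key : ∀ i, ∃ a : Fin 12, a.1 < 7 ∧ embedM0 a = x i := by decide
      obtain ⟨a, ha, hai⟩ := key i
      refine ⟨a, fun haS => ?_, hai⟩
      have := hS haS
      simp only [M0Extra, Set.mem_insert_iff, Set.mem_singleton_iff] at this
      omega
    · have key : ∀ a b, Compatible (embedM0 a) (embedM0 b) := by decide
      rintro _ ⟨a, -, rfl⟩ _ ⟨b, -, rfl⟩
      exact key a b

section Classification

variable {K : SimpleGraph V} {T : Set PartLabel}

theorem isThickeningOfM_of_subset_range (hT : IsAdmissible T)
    (hK : IsThickening K (pattern.induce T)) (f : M0 ↪g pattern)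
    (hf : ∀ a : Fin 12, a.1 < 7 → ∃ i, f a = x i) (hTf : ∀ a ∈ T, ∃ b, f b = a) :
    IsThickeningOfM K := by
  have e := induceImageIso f (f ⁻¹' T)
  rw [Set.image_preimage_eq_of_subset hTf] at e
  refine Or.inr <| Or.inr <| Or.inr ⟨(f ⁻¹' T)ᶜ, fun a ha => ?_, ?_⟩
  · have : ¬ a.1 < 7 := fun h => by
      obtain ⟨i, hi⟩ := hf a h
      exact ha (hi ▸ hT.x_mem i : f a ∈ T)
    simp only [M0Extra, Set.mem_insert_iff, Set.mem_singleton_iff]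
    omega
  · rw [compl_compl]
    exact hK.of_iso e.symm

theorem isThickening_of_range_eq {α : Type*} {M : SimpleGraph α}
    (hK : IsThickening K (pattern.induce T)) (f : M ↪g pattern) (hfT : ∀ b, f b ∈ T)
    (hTf : ∀ a ∈ T, ∃ b, f b = a) : IsThickening K M := by
  have e := induceRangeIso f
  rw [Set.Subset.antisymm (Set.range_subset_iff.2 hfT) hTf] at e
  exact hK.of_iso e.symm

theorem isThickeningOfM_of_y_zero_z_two (hT : IsAdmissible T)
    (hK : IsThickening K (pattern.induce T)) (hy : y 0 ∈ T) (hz : z 2 ∈ T) :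
    IsThickeningOfM K := by
  have hy' := fun a ha => hT.compatible _ hy a ha
  have hz' := fun a ha => hT.compatible _ hz a ha
  by_cases h1 : z 1 ∈ T
  · have key : ∀ a, Compatible (y 0) a → Compatible (z 2) a → Compatible (z 1) a →
      ∃ b, embedM2 b = a := by decide
    have hr : ∀ b, (∃ i, embedM2 b = x i) ∨ embedM2 b = y 0 ∨ embedM2 b = z 2 ∨
      embedM2 b = z 1 := by decide
    refine Or.inr <| Or.inl <| isThickening_of_range_eq hK embedM2 (fun b => ?_)
      fun a ha => key a (hy' a ha) (hz' a ha) (hT.compatible _ h1 a ha)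
    rcases hr b with ⟨i, h⟩ | h | h | h <;> rw [h]
    exacts [hT.x_mem i, hy, hz, h1]
  by_cases h3 : z 3 ∈ T
  · have key : ∀ a, Compatible (y 0) a → Compatible (z 2) a → Compatible (z 3) a →
      ∃ b, embedM3 b = a := by decide
    have hr : ∀ b, (∃ i, embedM3 b = x i) ∨ embedM3 b = y 0 ∨ embedM3 b = z 2 ∨
      embedM3 b = z 3 := by decide
    refine Or.inr <| Or.inr <| Or.inl <| isThickening_of_range_eq hK embedM3 (fun b => ?_)
      fun a ha => key a (hy' a ha) (hz' a ha) (hT.compatible _ h3 a ha)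
    rcases hr b with ⟨i, h⟩ | h | h | h <;> rw [h]
    exacts [hT.x_mem i, hy, hz, h3]
  · have key : ∀ a, Compatible (y 0) a → Compatible (z 2) a → a ≠ z 1 → a ≠ z 3 →
      ∃ b, embedM1 b = a := by decide
    have hr : ∀ b, (∃ i, embedM1 b = x i) ∨ embedM1 b = y 0 ∨ embedM1 b = z 2 := by decide
    refine Or.inl <| isThickening_of_range_eq hK embedM1 (fun b => ?_)
      fun a ha => key a (hy' a ha) (hz' a ha) (ne_of_mem_of_not_mem ha h1)
        (ne_of_mem_of_not_mem ha h3)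
    rcases hr b with ⟨i, h⟩ | h | h <;> rw [h]
    exacts [hT.x_mem i, hy, hz]

theorem isThickeningOfM_of_y_zero (hT : IsAdmissible T)
    (hK : IsThickening K (pattern.induce T)) (hy : y 0 ∈ T) (hz : z 2 ∉ T) (h3 : y 3 ∉ T)
    (h4 : y 4 ∉ T) : IsThickeningOfM K := by
  by_cases h1 : z 1 ∈ T
  · have key : ∀ a, Compatible (y 0) a → Compatible (z 1) a → a ≠ z 2 → a ≠ y 3 → a ≠ y 4 →
      ∃ b, embedM0Reflected b = a := by decide
    exact isThickeningOfM_of_subset_range hT hK embedM0Reflected (by decide) fun a ha =>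
      key a (hT.compatible _ hy a ha) (hT.compatible _ h1 a ha) (ne_of_mem_of_not_mem ha hz)
        (ne_of_mem_of_not_mem ha h3) (ne_of_mem_of_not_mem ha h4)
  · have key : ∀ a, Compatible (y 0) a → a ≠ z 1 → a ≠ z 2 → a ≠ y 3 → a ≠ y 4 →
      ∃ b, embedM0 b = a := by decide
    exact isThickeningOfM_of_subset_range hT hK embedM0 (by decide) fun a ha =>
      key a (hT.compatible _ hy a ha) (ne_of_mem_of_not_mem ha h1) (ne_of_mem_of_not_mem ha hz)
        (ne_of_mem_of_not_mem ha h3) (ne_of_mem_of_not_mem ha h4)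

theorem isThickeningOfM_of_forall_y_notMem (hT : IsAdmissible T)
    (hK : IsThickening K (pattern.induce T)) (hy : ∀ i, y i ∉ T) : IsThickeningOfM K := by
  by_cases hzz : ∃ i, z i ∈ T ∧ z (i + 1) ∈ T
  · obtain ⟨i, h3, h4⟩ := hzz
    have h3' : z 3 ∈ rotation (i - 3) ⁻¹' T := by simpa [rotation, shift] using h3
    have h4' : z 4 ∈ rotation (i - 3) ⁻¹' T := by
      have : i - 3 + 4 = i + 1 := by ring
      simpa [rotation, shift, this] using h4
    have key : ∀ a, Compatible (z 3) a → Compatible (z 4) a → (∀ j, a ≠ y j) →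
      ∃ b, embedM0 b = a := by decide
    have hT' := hT.rotate (i - 3)
    exact isThickeningOfM_of_subset_range hT' (isThickening_rotate hK (i - 3)) embedM0
      (by decide) fun a ha => key a (hT'.compatible _ h3' a ha) (hT'.compatible _ h4' a ha)
        fun j hj => hy _ (hj ▸ ha : y j ∈ rotation (i - 3) ⁻¹' T)
  push Not at hzz
  by_cases hz : ∃ i, z i ∈ T
  · obtain ⟨i, h0⟩ := hz
    have h0' : z 0 ∈ rotation i ⁻¹' T := by simpa [rotation, shift] using h0
    have h1' : z 1 ∉ rotation i ⁻¹' T := hzz i h0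
    have h6' : z 6 ∉ rotation i ⁻¹' T := fun h => by
      refine hzz _ h ?_
      have : i + 6 + 1 = i + 7 := by ring
      rw [this, show (7 : ZMod 7) = 0 from rfl, add_zero]
      exact h0
    have key : ∀ a, Compatible (z 0) a → a ≠ z 1 → a ≠ z 6 → (∀ j, a ≠ y j) →
      ∃ b, embedM0 b = a := by decide
    have hT' := hT.rotate i
    exact isThickeningOfM_of_subset_range hT' (isThickening_rotate hK i) embedM0
      (by decide) fun a ha => key a (hT'.compatible _ h0' a ha) (ne_of_mem_of_not_mem ha h1')
        (ne_of_mem_of_not_mem ha h6') fun j hj => hy _ (hj ▸ ha : y j ∈ rotation i ⁻¹' T)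
  · have key : ∀ a, (∀ j, a ≠ y j) → (∀ j, a ≠ z j) → ∃ b, embedM0 b = a := by decide
    exact isThickeningOfM_of_subset_range hT hK embedM0 (by decide) fun a ha =>
      key a (fun j hj => hy j (hj ▸ ha)) fun j hj => hz ⟨j, hj ▸ ha⟩

theorem isThickeningOfM_of_isAdmissible (hT : IsAdmissible T)
    (hK : IsThickening K (pattern.induce T)) : IsThickeningOfM K := by
  by_cases hyz : ∃ i, y i ∈ T ∧ z (i + 2) ∈ T
  · obtain ⟨i, hy, hz⟩ := hyz
    exact isThickeningOfM_of_y_zero_z_two (hT.rotate i) (isThickening_rotate hK i)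
      (by simpa [rotation, shift] using hy) hz
  push Not at hyz
  by_cases hyy : ∃ i, y i ∈ T ∧ y (i + 3) ∈ T
  · obtain ⟨i, h0, h3⟩ := hyy
    have h0' : y 0 ∈ rotation i ⁻¹' T := by simpa [rotation, shift] using h0
    have h3' : y 3 ∈ rotation i ⁻¹' T := h3
    have key : ∀ a, Compatible (y 0) a → Compatible (y 3) a → a ≠ z 2 →
      ∃ b, embedM0 b = a := by decide
    have hT' := hT.rotate i
    exact isThickeningOfM_of_subset_range hT' (isThickening_rotate hK i) embedM0
      (by decide) fun a ha => key a (hT'.compatible _ h0' a ha) (hT'.compatible _ h3' a ha)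
        (ne_of_mem_of_not_mem ha (hyz i h0))
  push Not at hyy
  by_cases hy : ∃ i, y i ∈ T
  · obtain ⟨i, h0⟩ := hy
    refine isThickeningOfM_of_y_zero (hT.rotate i) (isThickening_rotate hK i)
      (by simpa [rotation, shift] using h0) (hyz i h0) (hyy i h0) fun h => hyy _ h ?_
    have : i + 4 + 3 = i + 7 := by ring
    rw [this, show (7 : ZMod 7) = 0 from rfl, add_zero]
    exact h0
  · exact isThickeningOfM_of_forall_y_notMem hT hK (not_exists.1 hy)

end Classification

end PartLabel

section SpecialPartition

open PartLabel

variable {G : SimpleGraph V}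

theorem forall_zmod_seven {p : ZMod 7 → Prop} (h0 : p 0) (h1 : p 1) (h2 : p 2) (h3 : p 3)
    (h4 : p 4) (h5 : p 5) (h6 : p 6) : ∀ d, p d := by
  intro d
  have : ∀ d : ZMod 7, d = 0 ∨ d = 1 ∨ d = 2 ∨ d = 3 ∨ d = 4 ∨ d = 5 ∨ d = 6 := by decide
  rcases this d with rfl | rfl | rfl | rfl | rfl | rfl | rfl <;> assumption

/-- The family of parts of a special partition other than `W`. -/
def partFamily (X Y Z : ZMod 7 → Set V) : PartLabel → Set V
  | x i => X i
  | y i => Y i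
  | z i => Z i

theorem IsSpecialPartitionOn.isBlowup {X Y Z : ZMod 7 → Set V} {W : Set V}
    (h : IsSpecialPartitionOn G Set.univ X Y Z W) :
    IsBlowup G pattern (partFamily X Y Z) Wᶜ := by
  obtain ⟨dXX, dYY, dZZ, dXY, dXZ, dYZ, dXW, dYW, dZW, hU, cX, cY, cZ, -, -, hb, hc, hd, he,
    hf, hg⟩ := h
  have jxx : ∀ i d, Joined (x i) (x (i + d)) ↔ d = 1 ∨ d = 6 := by decide
  have jxy : ∀ i d, Joined (x i) (y (i + d)) ↔ d = 0 ∨ d = 3 ∨ d = 6 := by decide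
  have jxz : ∀ i d, Joined (x i) (z (i + d)) ↔ d ≠ 1 ∧ d ≠ 2 := by decide
  have jyy : ∀ i d, Joined (y i) (y (i + d)) ↔ d ≠ 0 := by decide
  have jyz : ∀ i d, Joined (y i) (z (i + d)) ↔ d ≠ 2 := by decide
  have jzz : ∀ i d, Joined (z i) (z (i + d)) ↔ d ≠ 0 := by decide
  have sub_one : ∀ i : ZMod 7, i - 1 = i + 6 := by decide
  have pxx : ∀ d, d ≠ 0 → ∀ i, (Joined (x i) (x (i + d)) → Complete G (X i) (X (i + d))) ∧
      (¬ Joined (x i) (x (i + d)) → Anticomplete G (X i) (X (i + d))) := by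
    simp only [jxx]
    apply forall_zmod_seven <;> intro hd i <;>
    obtain ⟨h6, h1, h2, h3, h4, h5⟩ := hb i <;> rw [sub_one] at h6 <;>
    first
      | exact absurd rfl hd
      | exact ⟨fun _ => by assumption, fun hn => absurd (by decide) hn⟩
      | exact ⟨fun hp => absurd hp (by decide), fun _ => by assumption⟩
  have pxy : ∀ d i, (Joined (x i) (y (i + d)) → Complete G (X i) (Y (i + d))) ∧
      (¬ Joined (x i) (y (i + d)) → Anticomplete G (X i) (Y (i + d))) := by
    simp only [jxy]
    apply forall_zmod_seven <;> intro i <;> try rw [add_zero]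
    all_goals
      obtain ⟨h0, h3, h6, -, -, -, -, -, -, h1, h2, h4, h5, -, -⟩ := hc i
      first
      | exact ⟨fun _ => by assumption, fun hn => absurd (by decide) hn⟩
      | exact ⟨fun hp => absurd hp (by decide), fun _ => by assumption⟩
  have pxz : ∀ d i, (Joined (x i) (z (i + d)) → Complete G (X i) (Z (i + d))) ∧
      (¬ Joined (x i) (z (i + d)) → Anticomplete G (X i) (Z (i + d))) := by
    simp only [jxz]
    apply forall_zmod_seven <;> intro i <;> try rw [add_zero]
    all_goals
      obtain ⟨-, -, -, h0, h3, h4, h5, h6, -, -, -, -, -, h1, h2⟩ := hc i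
      first
      | exact ⟨fun _ => by assumption, fun hn => absurd (by decide) hn⟩
      | exact ⟨fun hp => absurd hp (by decide), fun _ => by assumption⟩
  have pyy : ∀ d, d ≠ 0 → ∀ i, Complete G (Y i) (Y (i + d)) := by
    intro d hd0 i
    obtain hi | hi := (Y i).eq_empty_or_nonempty
    · exact complete_of_eq_empty_left hi
    obtain ⟨⟨h1, h2, h5, h6, -, -⟩, -⟩ := hd i hi
    obtain ⟨h3, h4, -⟩ := hf i
    revert d
    apply forall_zmod_seven <;> intro hd0 <;>
    first
      | exact absurd rfl hd0
      | assumption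
      | (apply complete_of_eq_empty_right; assumption)
  have pyz : ∀ d i, (Joined (y i) (z (i + d)) → Complete G (Y i) (Z (i + d))) ∧
      (¬ Joined (y i) (z (i + d)) → Anticomplete G (Y i) (Z (i + d))) := by
    simp only [jyz]
    intro d i
    obtain ⟨-, -, h0, h1, h3, h4, -, h2⟩ := hf i
    refine ⟨fun hd2 => ?_, fun hd2 => by rwa [not_not.1 hd2]⟩
    obtain hi | hi := (Y i).eq_empty_or_nonempty
    · exact complete_of_eq_empty_left hi
    obtain ⟨⟨-, -, -, -, h5, h6⟩, -⟩ := hd i hi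
    rw [← add_zero i] at h0
    revert d
    apply forall_zmod_seven <;> intro hd2 <;>
    first
      | exact absurd rfl hd2
      | assumption
      | simpa only [add_zero] using h0
      | (apply complete_of_eq_empty_right; assumption)
  have pzz : ∀ d, d ≠ 0 → ∀ i, Complete G (Z i) (Z (i + d)) := by
    intro d hd0 i
    obtain hi | hi := (Z i).eq_empty_or_nonempty
    · exact complete_of_eq_empty_left hi
    obtain ⟨h2, h5⟩ := he i hi
    obtain ⟨h1, h3, h4, h6, -⟩ := hg i
    revert d
    apply forall_zmod_seven <;> intro hd0 <;>
    first
      | exact absurd rfl hd0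
      | assumption
      | (apply complete_of_eq_empty_right; assumption)
  have pairs : ∀ a b, a ≠ b →
      (Joined a b → Complete G (partFamily X Y Z a) (partFamily X Y Z b)) ∧
      (¬ Joined a b → Anticomplete G (partFamily X Y Z a) (partFamily X Y Z b)) := by
    rintro (i | i | i) (j | j | j) hij
    · obtain ⟨d, rfl⟩ : ∃ d, j = i + d := ⟨j - i, by ring⟩
      exact pxx d (by rintro rfl; simp at hij) i
    · obtain ⟨d, rfl⟩ : ∃ d, j = i + d := ⟨j - i, by ring⟩
      exact pxy d i
    · obtain ⟨d, rfl⟩ : ∃ d, j = i + d := ⟨j - i, by ring⟩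
      exact pxz d i
    · obtain ⟨d, rfl⟩ : ∃ d, i = j + d := ⟨i - j, by ring⟩
      exact (pxy d j).imp (fun h hj => (h hj).symm) fun h hj => (h hj).symm
    · obtain ⟨d, rfl⟩ : ∃ d, j = i + d := ⟨j - i, by ring⟩
      have hd : d ≠ 0 := by rintro rfl; simp at hij
      exact ⟨fun _ => pyy d hd i, fun h => absurd ((jyy i d).2 hd) h⟩
    · obtain ⟨d, rfl⟩ : ∃ d, j = i + d := ⟨j - i, by ring⟩
      exact pyz d i
    · obtain ⟨d, rfl⟩ : ∃ d, i = j + d := ⟨i - j, by ring⟩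
      exact (pxz d j).imp (fun h hj => (h hj).symm) fun h hj => (h hj).symm
    · obtain ⟨d, rfl⟩ : ∃ d, i = j + d := ⟨i - j, by ring⟩
      exact (pyz d j).imp (fun h hj => (h hj).symm) fun h hj => (h hj).symm
    · obtain ⟨d, rfl⟩ : ∃ d, j = i + d := ⟨j - i, by ring⟩
      have hd : d ≠ 0 := by rintro rfl; simp at hij
      exact ⟨fun _ => pzz d hd i, fun h => absurd ((jzz i d).2 hd) h⟩
  refine ⟨?_, ?_, ?_, fun a b hab => (pairs a b hab.ne).1 hab, fun a b hab => (pairs a b hab).2⟩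
  · rintro (i | i | i) (j | j | j) hij
    exacts [dXX i j (by simpa using hij), dXY i j, dXZ i j, (dXY j i).symm,
      dYY i j (by simpa using hij), dYZ i j, (dXZ j i).symm, (dYZ j i).symm,
      dZZ i j (by simpa using hij)]
  · refine Set.Subset.antisymm (Set.iUnion_subset ?_) fun v hv => ?_
    · rintro (i | i | i)
      exacts [(dXW i).subset_compl_right, (dYW i).subset_compl_right,
        (dZW i).subset_compl_right]
    · have := hU.symm ▸ Set.mem_univ v
      simp only [Set.mem_union, Set.mem_iUnion] at this ⊢
      obtain ((⟨i, h⟩ | ⟨i, h⟩) | ⟨i, h⟩) | h := this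
      exacts [⟨x i, h⟩, ⟨y i, h⟩, ⟨z i, h⟩, absurd h hv]
  · rintro (i | i | i)
    exacts [cX i, cY i, cZ i]

theorem IsSpecialPartitionOn.isAdmissible {S : Set V} {X Y Z : ZMod 7 → Set V} {W : Set V}
    (h : IsSpecialPartitionOn G S X Y Z W) :
    IsAdmissible {a | (partFamily X Y Z a).Nonempty} := by
  obtain ⟨-, -, -, -, -, -, -, -, -, -, -, -, -, -, ha, -, -, hd, he, -, -⟩ := h
  have qyy : ∀ d i, (Y i).Nonempty → (Y (i + d)).Nonempty → d = 0 ∨ d = 3 ∨ d = 4 := by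
    intro d i hi
    obtain ⟨⟨h1, h2, h5, h6, -, -⟩, -⟩ := hd i hi
    revert d
    apply forall_zmod_seven <;> intro hj <;> simp_all
  have qyz : ∀ d i, (Y i).Nonempty → (Z (i + d)).Nonempty → d ≠ 5 ∧ d ≠ 6 := by
    rintro d i hi hj
    obtain ⟨⟨-, -, -, -, h5, h6⟩, -⟩ := hd i hi
    exact ⟨by rintro rfl; exact hj.ne_empty h5, by rintro rfl; exact hj.ne_empty h6⟩
  have qzz : ∀ d i, (Z i).Nonempty → (Z (i + d)).Nonempty → d ≠ 2 ∧ d ≠ 5 := by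
    rintro d i hi hj
    obtain ⟨h2, h5⟩ := he i hi
    exact ⟨by rintro rfl; exact hj.ne_empty h2, by rintro rfl; exact hj.ne_empty h5⟩
  refine ⟨ha, ?_⟩
  rintro (i | i | i) hi (j | j | j) hj
  any_goals trivial
  · exact qyy (j - i) i hi (by simpa [partFamily] using hj)
  · exact qyz (j - i) i hi (by simpa [partFamily] using hj)
  · exact qyz (i - j) j hj (by simpa [partFamily] using hi)
  · exact qzz (j - i) i hi (by simpa [partFamily] using hj)

theorem IsBlowup.isSpecialPartitionOn {P : PartLabel → Set V} {S : Set V}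
    (h : IsBlowup G pattern P S) (hS : G.IsClique Sᶜ) (hSS : Complete G Sᶜ S)
    (hT : IsAdmissible {a | (P a).Nonempty}) :
    IsSpecialPartitionOn G Set.univ (fun i => P (x i)) (fun i => P (y i)) (fun i => P (z i))
      Sᶜ := by
  have hsub : ∀ a, P a ⊆ S := fun a => h.iUnion_eq ▸ Set.subset_iUnion P a
  have hW : ∀ a, Complete G (P a) Sᶜ := fun a u hu w hw => (hSS w hw u (hsub a hu)).symm
  have hdW : ∀ a, Disjoint (P a) Sᶜ := fun a => Set.disjoint_compl_right_iff_subset.2 (hsub a)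
  have hc : ∀ {a b}, Joined a b → Complete G (P a) (P b) := fun {a b} => h.complete a b
  have hn : ∀ {a b}, a ≠ b ∧ ¬ Joined a b → Anticomplete G (P a) (P b) :=
    fun {a b} hab => h.anticomplete a b hab.1 hab.2
  have he : ∀ {a b}, ¬ Compatible a b → (P a).Nonempty → P b = ∅ := fun hab ha =>
    Set.not_nonempty_iff_eq_empty.1 fun hb => hab (hT.compatible _ ha _ hb)
  refine ⟨fun i j hij => h.disjoint _ _ (by simpa using hij),
    fun i j hij => h.disjoint _ _ (by simpa using hij),
    fun i j hij => h.disjoint _ _ (by simpa using hij),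
    fun i j => h.disjoint _ _ (by simp), fun i j => h.disjoint _ _ (by simp),
    fun i j => h.disjoint _ _ (by simp), fun i => hdW _, fun i => hdW _, fun i => hdW _, ?_,
    fun i => h.isClique _, fun i => h.isClique _, fun i => h.isClique _, hS, hT.x_mem,
    fun i => ⟨?_, ?_, ?_, ?_, ?_, ?_⟩,
    fun i => ⟨?_, ?_, ?_, ?_, ?_, ?_, ?_, ?_, hW _, ?_, ?_, ?_, ?_, ?_, ?_⟩,
    fun i hi => ⟨⟨he ?_ hi, he ?_ hi, he ?_ hi, he ?_ hi, he ?_ hi, he ?_ hi⟩, ?not_both⟩,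
    fun i hi => ⟨he ?_ hi, he ?_ hi⟩,
    fun i => ⟨?_, ?_, ?_, ?_, ?_, ?_, hW _, ?_⟩,
    fun i => ⟨?_, ?_, ?_, ?_, hW _⟩⟩
  · refine Set.eq_univ_of_forall fun v => ?_
    by_cases hv : v ∈ S
    · obtain ⟨a, ha⟩ := Set.mem_iUnion.1 (h.iUnion_eq.symm ▸ hv : v ∈ ⋃ a, P a)
      simp only [Set.mem_union, Set.mem_iUnion]
      rcases a with i | i | i
      exacts [.inl (.inl (.inl ⟨i, ha⟩)), .inl (.inl (.inr ⟨i, ha⟩)), .inl (.inr ⟨i, ha⟩)]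
    · exact .inr hv
  case not_both =>
    refine (P (y (i + 3))).eq_empty_or_nonempty.imp_right (he ?_)
    clear hi
    revert i
    decide
  all_goals first
    | (apply hc; revert i; decide)
    | (apply hn; revert i; decide)
    | (clear hi; revert i; decide)

theorem admitsSpecialPartition_iff :
    AdmitsSpecialPartition G ↔ ∃ S : Set V,
      (∃ P : PartLabel → Set V,
        IsBlowup G pattern P S ∧ IsAdmissible {a | (P a).Nonempty}) ∧
      G.IsClique Sᶜ ∧ Complete G Sᶜ S := by
  constructor
  · rintro ⟨X, Y, Z, W, h⟩
    have hP := h.isBlowup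
    refine ⟨Wᶜ, ⟨_, hP, h.isAdmissible⟩, ?_⟩
    obtain ⟨-, -, -, -, -, -, -, -, -, -, -, -, -, hW, -, -, hc, -, -, hf, hg⟩ := h
    rw [compl_compl]
    refine ⟨hW, Complete.symm ?_⟩
    rw [← hP.iUnion_eq]
    intro v hv w hw
    obtain ⟨a, ha⟩ := Set.mem_iUnion.1 hv
    rcases a with i | i | i
    · obtain ⟨-, -, -, -, -, -, -, -, h, -⟩ := hc i
      exact h v ha w hw
    · obtain ⟨-, -, -, -, -, -, h, -⟩ := hf i
      exact h v ha w hw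
    · obtain ⟨-, -, -, -, h⟩ := hg i
      exact h v ha w hw
  · rintro ⟨S, ⟨P, hP, hT⟩, hS, hSS⟩
    exact ⟨_, _, _, _, hP.isSpecialPartitionOn hS hSS hT⟩

end SpecialPartition

/-- A graph admits a special partition if and only if it can be obtained from a
thickening of a graph in the family `ℳ` by possibly adding universal vertices. -/
theorem statement5 {V : Type*} [Fintype V] (G : SimpleGraph V) :
    AdmitsSpecialPartition G ↔
    ∃ S : Set V, IsThickeningOfM (G.induce S) ∧ G.IsClique Sᶜ ∧ Complete G Sᶜ S := by
  rw [admitsSpecialPartition_iff]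
  refine exists_congr fun S => and_congr_left fun _ => ⟨?_, ?_⟩
  · rintro ⟨P, hP, hT⟩
    exact PartLabel.isThickeningOfM_of_isAdmissible hT hP.isThickening_induce
  · intro h
    obtain ⟨T, hT, hK⟩ := PartLabel.exists_isAdmissible_of_isThickeningOfM h
    obtain ⟨P, hP, rfl⟩ := hK.exists_isBlowup
    exact ⟨P, hP, hT⟩

end Paper2P3
end

section
/- Let G be a (P_7,C_4,C_6)-free graph, let x_0,x_1,…,x_6,x_0 (indices in ℤ_7) be an induced 7-cycle in G, and let v be a vertex of G not among x_0,…,x_6. Then one of the following holds: (a) v has no neighbor in {x_0,…,x_6}; (b) there is i ∈ ℤ_7 with N_G(v) ∩ {x_0,…,x_6} = {x_{i−1},x_i,x_{i+1}}; (c) there is i ∈ ℤ_7 with N_G(v) ∩ {x_0,…,x_6} = {x_i,x_{i+1},x_{i+4}}; (d) there is i ∈ ℤ_7 with N_G(v) ∩ {x_0,…,x_6} = {x_i,x_{i+1},x_{i+2},x_{i+3},x_{i+4}}; (e) v is adjacent to all of x_0,…,x_6. -/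
open SimpleGraph

namespace Paper2P3

variable {V : Type*}

/-- A graph containing an embedded copy of `H` is not `H`-free. -/
lemma HFree.false_of_embedding {V W : Type*} {G : SimpleGraph V} {H : SimpleGraph W}
    (h : HFree G H) (f : H ↪g G) : False :=
  h ⟨Set.range f, ⟨⟨Equiv.ofInjective f f.injective, f.map_adj_iff⟩⟩⟩

/-- In `ℤ_7`, two integers below `6` differ by one exactly when they do so in `ℕ`. -/
lemma zmod_seven_consecutive_iff {k l : ℕ} (hk : k < 6) (hl : l < 6) (i : ZMod 7) :
    (i + l = i + k + 1 ∨ i + l = i + k - 1) ↔ (k + 1 = l ∨ l + 1 = k) := by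
  rw [add_assoc, add_sub_assoc, add_right_inj, add_right_inj]
  revert l
  revert k
  decide

lemma zmod_seven_natCast_inj {k l : ℕ} (hk : k < 6) (hl : l < 6)
    (h : (k : ZMod 7) = l) : k = l := by
  rwa [ZMod.natCast_eq_natCast_iff', Nat.mod_eq_of_lt (by omega),
    Nat.mod_eq_of_lt (by omega)] at h

/-- If `H` consists of a path with vertices `1, …, m` and a vertex `0`, then in an `H`-free graph
no vertex off an induced `7`-cycle attaches to `m ≤ 6` consecutive vertices of the cycle in the way
that `0` attaches to the path. -/
lemma HFree.false_of_attachment {V : Type*} {G : SimpleGraph V} {m : ℕ}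
    {H : SimpleGraph (Fin (m + 1))} (hH : HFree G H) (hm : m ≤ 6)
    (hpath : ∀ k l : Fin m, H.Adj k.succ l.succ ↔ (k.val + 1 = l.val ∨ l.val + 1 = k.val))
    {x : ZMod 7 → V} (hinj : Function.Injective x)
    (hadj : ∀ i j : ZMod 7, G.Adj (x i) (x j) ↔ (j = i + 1 ∨ j = i - 1))
    {v : V} (hv : ∀ i, v ≠ x i) (i : ZMod 7)
    (hatt : ∀ k : Fin m, G.Adj v (x (i + (k.val : ZMod 7))) ↔ H.Adj 0 k.succ) : False := by
  refine hH.false_of_embedding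
    ⟨⟨Fin.cons v fun k : Fin m => x (i + (k.val : ZMod 7)), ?_⟩, ?_⟩
  · refine Fin.cons_injective_iff.2 ⟨?_, fun k l h => ?_⟩
    · rintro ⟨k, hk⟩
      exact hv _ hk.symm
    · exact Fin.ext (zmod_seven_natCast_inj (by omega) (by omega) (add_left_cancel (hinj h)))
  · intro a b
    induction a using Fin.cases with
    | zero =>
      induction b using Fin.cases with
      | zero => simp
      | succ l => simpa using hatt l
    | succ k =>
      induction b using Fin.cases with
      | zero => simpa [G.adj_comm, H.adj_comm] using hatt k
      | succ l =>
        simpa [hadj, hpath] using zmod_seven_consecutive_iff (by omega) (by omega) i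

set_option synthInstance.maxSize 2000 in
/-- A binary word around `ℤ_7` whose maximal runs of zeros have lengths in `{0, 2, 4, 7}` is, up to
rotation, one of the five listed. -/
lemma zmod_seven_pattern : ∀ b : ZMod 7 → Bool,
    (∀ i, ¬ (b i ∧ ¬ b (i + 1) ∧ b (i + 2))) →
    (∀ i, ¬ (b i ∧ ¬ b (i + 1) ∧ ¬ b (i + 2) ∧ ¬ b (i + 3) ∧ b (i + 4))) →
    (∀ i, ¬ (b i ∧ ¬ b (i + 1) ∧ ¬ b (i + 2) ∧ ¬ b (i + 3) ∧ ¬ b (i + 4) ∧ ¬ b (i + 5))) →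
    (∀ k, ¬ b k) ∨
    (∃ i : ZMod 7, ∀ k, b k ↔ (k = i - 1 ∨ k = i ∨ k = i + 1)) ∨
    (∃ i : ZMod 7, ∀ k, b k ↔ (k = i ∨ k = i + 1 ∨ k = i + 4)) ∨
    (∃ i : ZMod 7, ∀ k, b k ↔ (k = i ∨ k = i + 1 ∨ k = i + 2 ∨ k = i + 3 ∨ k = i + 4)) ∨
    (∀ k, b k) := by
  decide +kernel

/-- Attachments of a vertex to an induced 7-cycle in a `(P_7,C_4,C_6)`-free graph. -/
theorem statement7 {V : Type*} [Fintype V] (G : SimpleGraph V)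
    (hP7 : HFree G (pathGraph 7)) (hC4 : HFree G (cycleGraph 4))
    (hC6 : HFree G (cycleGraph 6))
    (x : ZMod 7 → V) (hinj : Function.Injective x)
    (hadj : ∀ i j : ZMod 7, G.Adj (x i) (x j) ↔ (j = i + 1 ∨ j = i - 1))
    (v : V) (hv : ∀ i, v ≠ x i) :
    (∀ k, ¬ G.Adj v (x k)) ∨
    (∃ i : ZMod 7, ∀ k, G.Adj v (x k) ↔ (k = i - 1 ∨ k = i ∨ k = i + 1)) ∨
    (∃ i : ZMod 7, ∀ k, G.Adj v (x k) ↔ (k = i ∨ k = i + 1 ∨ k = i + 4)) ∨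
    (∃ i : ZMod 7, ∀ k, G.Adj v (x k) ↔
      (k = i ∨ k = i + 1 ∨ k = i + 2 ∨ k = i + 3 ∨ k = i + 4)) ∨
    (∀ k, G.Adj v (x k)) := by
  classical
  have h := zmod_seven_pattern fun k => decide (G.Adj v (x k))
  simp only [decide_eq_true_eq] at h
  refine h (fun i hi => ?_) (fun i hi => ?_) (fun i hi => ?_)
  · refine hC4.false_of_attachment (m := 3) (by norm_num) (by decide) hinj hadj hv i fun k => ?_
    fin_cases k <;> simp [hi, cycleGraph_adj] <;> decide
  · refine hC6.false_of_attachment (m := 5) (by norm_num) (by decide) hinj hadj hv i fun k => ?_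
    fin_cases k <;> simp [hi, cycleGraph_adj] <;> decide
  · refine hP7.false_of_attachment (m := 6) (by norm_num) (by simp [pathGraph_adj]) hinj hadj hv i
      fun k => ?_
    fin_cases k <;> simp [hi, pathGraph_adj]

end Paper2P3
end
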